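/- Generalized Cherednik–Macdonald identity for the rank-one root system A₁: for ω₊, ω₋ ∈ ℂ₊ with Im(ω₊ω₋) < 0 and k ∈ ℂ₋ ∩ ω₊ω₋ℂ₊, ∫_ℝ G(v+iω) G(−v+iω) / ( G(v+i(k+ω)) G(−v+i(k+ω)) ) dv = 4 √(ω₊ω₋) · G(i(k+ω)) G(i(k−ω)) / G(i(2k+ω)), with the integral absolutely convergent. -/

import Mathlib

open MeasureTheory Set
open scoped BigOperators Classical

noncomputable section

/-- Ruijsenaars' hyperbolic gamma function `G(ω₊,ω₋;z)`, defined by the integral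
representation, valid on the strip `|Im z| < Re((ω₊+ω₋)/2)`. -/
def hypGammaInt (op om z : ℂ) : ℂ :=
  Complex.exp (Complex.I * ∫ y in Set.Ioi (0:ℝ),
    (1/(y:ℂ)) * (Complex.sin (2*(y:ℂ)*z) /
        (2 * Complex.sinh (op*(y:ℂ)) * Complex.sinh (om*(y:ℂ)))
      - z/(op*om*(y:ℂ))))

/-- The locus `-iω - Λ` (with `ω = (ω₊+ω₋)/2`, `Λ = ℤ≥0·iω₊ + ℤ≥0·iω₋`) containing the
poles of the hyperbolic gamma function; off this set the meromorphic extension is defined. -/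
def hypGammaPoles (op om : ℂ) : Set ℂ :=
  {z | ∃ m n : ℕ, z = -Complex.I*(op+om)/2 - (m:ℂ)*Complex.I*op - (n:ℂ)*Complex.I*om}

/-- Predicate expressing that `G : ℂ → ℂ` is the meromorphic extension in `z` of
Ruijsenaars' hyperbolic gamma function with quasi-periods `ω₊ = op`, `ω₋ = om`:
it agrees with the integral representation on the strip `|Im z| < Re((ω₊+ω₋)/2)`,
satisfies both functional equations (away from the zeros of the `cosh` factor, where
the two sides have poles), and is continuous away from the pole locus. -/
structure IsHypGamma (op om : ℂ) (G : ℂ → ℂ) : Prop where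
  strip : ∀ z : ℂ, |z.im| < ((op+om)/2).re → G z = hypGammaInt op om z
  funEqm : ∀ z : ℂ, Complex.cosh (Real.pi * z / op) ≠ 0 →
    G (z + Complex.I * om/2) = 2 * Complex.cosh (Real.pi * z / op) * G (z - Complex.I * om/2)
  funEqp : ∀ z : ℂ, Complex.cosh (Real.pi * z / om) ≠ 0 →
    G (z + Complex.I * op/2) = 2 * Complex.cosh (Real.pi * z / om) * G (z - Complex.I * op/2)
  cont : ContinuousOn G (hypGammaPoles op om)ᶜ

open Complex (I)
open Filter Topology

/-! ### Elementary bounds for hyperbolic functions -/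

theorem norm_exp_le_exp_abs_re (u : ℂ) : ‖Complex.exp u‖ ≤ Real.exp |u.re| := by
  rw [Complex.norm_exp]
  exact Real.exp_le_exp.2 (le_abs_self _)

theorem norm_sinh_le_exp (u : ℂ) : ‖Complex.sinh u‖ ≤ Real.exp |u.re| := by
  rw [Complex.sinh, norm_div, Complex.norm_ofNat, div_le_iff₀ two_pos]
  have h1 := norm_exp_le_exp_abs_re u
  have h2 := norm_exp_le_exp_abs_re (-u)
  rw [Complex.neg_re, abs_neg] at h2
  linarith [norm_sub_le (Complex.exp u) (Complex.exp (-u))]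

theorem norm_cosh_le_exp (u : ℂ) : ‖Complex.cosh u‖ ≤ Real.exp |u.re| := by
  rw [Complex.cosh, norm_div, Complex.norm_ofNat, div_le_iff₀ two_pos]
  have h1 := norm_exp_le_exp_abs_re u
  have h2 := norm_exp_le_exp_abs_re (-u)
  rw [Complex.neg_re, abs_neg] at h2
  linarith [norm_add_le (Complex.exp u) (Complex.exp (-u))]

theorem sin_eq_neg_I_mul_sinh (w : ℂ) : Complex.sin w = -I * Complex.sinh (w * I) := by
  rw [Complex.sinh_mul_I]
  linear_combination Complex.sin w * Complex.I_sq

theorem norm_sin_le_exp (w : ℂ) : ‖Complex.sin w‖ ≤ Real.exp |w.im| := by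
  rw [sin_eq_neg_I_mul_sinh, norm_mul, norm_neg, Complex.norm_I, one_mul]
  simpa using norm_sinh_le_exp (w * I)

theorem norm_sinh_sub_self_le (u : ℂ) :
    ‖Complex.sinh u - u‖ ≤ 2 * ‖u‖ ^ 3 * Real.exp |u.re| := by
  have hexp : 1 ≤ Real.exp |u.re| := Real.one_le_exp (abs_nonneg _)
  rcases le_or_gt ‖u‖ 1 with hu | hu
  · have h1 := Complex.exp_bound hu (n := 3) (by norm_num)
    have h2 := Complex.exp_bound (x := -u) (by simpa using hu) (n := 3) (by norm_num)
    simp only [Finset.sum_range_succ, Finset.sum_range_zero, norm_neg] at h1 h2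
    norm_num [Nat.factorial] at h1 h2
    have h3 : Complex.sinh u - u =
        ((Complex.exp u - (1 + u + u ^ 2 / 2)) - (Complex.exp (-u) - (1 + -u + u ^ 2 / 2))) / 2 := by
      rw [Complex.sinh]; ring
    rw [h3, norm_div, Complex.norm_ofNat, div_le_iff₀ two_pos]
    refine (norm_sub_le _ _).trans ?_
    have h0 : 0 ≤ ‖u‖ ^ 3 := by positivity
    nlinarith
  · have h1 := norm_sinh_le_exp u
    have h2 : 1 ≤ ‖u‖ ^ 3 := one_le_pow₀ hu.le
    have h3 : ‖u‖ ≤ ‖u‖ ^ 3 := by nlinarith [sq_nonneg ‖u‖]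
    have h4 := norm_sub_le (Complex.sinh u) u
    have h5 : 0 ≤ ‖u‖ := norm_nonneg _
    nlinarith [mul_nonneg (sub_nonneg.2 h2) (sub_nonneg.2 hexp)]

theorem norm_sin_sub_self_le (w : ℂ) :
    ‖Complex.sin w - w‖ ≤ 2 * ‖w‖ ^ 3 * Real.exp |w.im| := by
  have h : Complex.sin w - w = -I * (Complex.sinh (w * I) - w * I) := by
    rw [sin_eq_neg_I_mul_sinh]
    linear_combination (-w) * Complex.I_sq
  rw [h, norm_mul, norm_neg, Complex.norm_I, one_mul]
  simpa using norm_sinh_sub_self_le (w * I)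

theorem sinh_re_le_norm_sinh (u : ℂ) : Real.sinh u.re ≤ ‖Complex.sinh u‖ := by
  rw [Complex.sinh, norm_div, Complex.norm_ofNat, Real.sinh_eq]
  have h := norm_sub_norm_le (Complex.exp u) (Complex.exp (-u))
  rw [Complex.norm_exp, Complex.norm_exp, Complex.neg_re] at h
  gcongr

theorem sinh_ne_zero_of_re_pos {u : ℂ} (hu : 0 < u.re) : Complex.sinh u ≠ 0 := by
  have h := sinh_re_le_norm_sinh u
  have h2 : 0 < Real.sinh u.re := Real.sinh_pos_iff.2 hu
  exact norm_pos_iff.1 (h2.trans_le h)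

theorem re_le_norm_sinh {u : ℂ} (hu : 0 ≤ u.re) : u.re ≤ ‖Complex.sinh u‖ :=
  (Real.self_le_sinh_iff.2 hu).trans (sinh_re_le_norm_sinh u)

theorem exp_re_le_norm_sinh {u : ℂ} {m : ℝ} (hu : m ≤ u.re) :
    (1 - Real.exp (-2 * m)) / 2 * Real.exp u.re ≤ ‖Complex.sinh u‖ := by
  refine le_trans ?_ (sinh_re_le_norm_sinh u)
  rw [Real.sinh_eq]
  have h : Real.exp (-u.re) ≤ Real.exp (-2 * m) * Real.exp u.re := by
    rw [← Real.exp_add]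
    exact Real.exp_le_exp.2 (by linarith)
  linarith

/-! ### The kernel of the integral representation -/

/-- The integrand of `hypGammaInt`. -/
def hypGammaKernel (op om z : ℂ) (y : ℝ) : ℂ :=
  (1/(y:ℂ)) * (Complex.sin (2*(y:ℂ)*z) /
        (2 * Complex.sinh (op*(y:ℂ)) * Complex.sinh (om*(y:ℂ)))
      - z/(op*om*(y:ℂ)))

theorem hypGammaKernel_bound_small {op om : ℂ} {m M D : ℝ} (hm : 0 < m)
    (h1 : m ≤ op.re) (h2 : m ≤ om.re) (h3 : ‖op‖ ≤ M) (h4 : ‖om‖ ≤ M)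
    (hD : D = 2 * M ^ 3 * Real.exp M) (z : ℂ) {y : ℝ}
    (hy0 : 0 < y) (hy1 : y ≤ 1) :
    ‖hypGammaKernel op om z y‖ ≤
      8 / m ^ 2 * (‖z‖ ^ 3 * Real.exp (2 * y * |z.im|)) + D * (D + 2 * M) / m ^ 4 * ‖z‖ := by
  have hop : 0 < op.re := hm.trans_le h1
  have hom : 0 < om.re := hm.trans_le h2
  have hyc : (y : ℂ) ≠ 0 := by exact_mod_cast hy0.ne'
  have hopn : op ≠ 0 := fun h => by simp [h] at hop
  have homn : om ≠ 0 := fun h => by simp [h] at hom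
  have hM : 0 < M := hm.trans_le (h1.trans ((Complex.re_le_norm op).trans h3))
  have hD0 : 0 < D := by rw [hD]; positivity
  have re1 : (op * (y:ℂ)).re = op.re * y := by simp
  have re2 : (om * (y:ℂ)).re = om.re * y := by simp
  have hn : ∀ a : ℂ, ‖a‖ ≤ M → ‖a * (y:ℂ)‖ ≤ M * y := by
    intro a ha
    rw [norm_mul, Complex.norm_real, Real.norm_eq_abs, abs_of_pos hy0]
    gcongr
  have hd : ∀ a : ℂ, ‖a‖ ≤ M → ‖Complex.sinh (a * (y:ℂ)) - a * (y:ℂ)‖ ≤ D * y ^ 3 := by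
    intro a ha
    refine (norm_sinh_sub_self_le _).trans ?_
    have : |(a * (y:ℂ)).re| ≤ M :=
      (Complex.abs_re_le_norm _).trans ((hn a ha).trans (by nlinarith))
    calc _ ≤ 2 * (M * y) ^ 3 * Real.exp M := by gcongr; exact hn a ha
      _ = D * y ^ 3 := by rw [hD]; ring
  have l1 : m * y ≤ ‖Complex.sinh (op * (y:ℂ))‖ := by
    refine le_trans ?_ (re_le_norm_sinh (by rw [re1]; positivity))
    rw [re1]; gcongr
  have l2 : m * y ≤ ‖Complex.sinh (om * (y:ℂ))‖ := by
    refine le_trans ?_ (re_le_norm_sinh (by rw [re2]; positivity))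
    rw [re2]; gcongr
  have d1 := hd op h3
  have d2 := hd om h4
  have e1 := hn op h3
  have e2 := hn om h4
  rw [hypGammaKernel]
  generalize Complex.sinh (op * (y:ℂ)) = s1 at *
  generalize Complex.sinh (om * (y:ℂ)) = s2 at *
  have n1 : s1 ≠ 0 := norm_pos_iff.1 (lt_of_lt_of_le (by positivity) l1)
  have n2 : s2 ≠ 0 := norm_pos_iff.1 (lt_of_lt_of_le (by positivity) l2)
  have u2 : ‖s2‖ ≤ (D + M) * y := by
    have hy3 : D * y ^ 3 ≤ D * y := by
      have : y ^ 3 ≤ y := by nlinarith [mul_pos hy0 hy0]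
      gcongr
    have := norm_add_le (s2 - om * y) (om * y)
    rw [sub_add_cancel] at this
    linarith
  have hsplit : (1/(y:ℂ)) * (Complex.sin (2*(y:ℂ)*z) / (2 * s1 * s2) - z/(op*om*(y:ℂ))) =
      (Complex.sin (2*(y:ℂ)*z) - 2*(y:ℂ)*z) / (2 * y * s1 * s2)
        + z * (-((s1 - op * y) * s2 + op * y * (s2 - om * y)) / (op * om * y ^ 2 * s1 * s2)) := by
    field_simp
    ring
  rw [hsplit]
  refine (norm_add_le _ _).trans (add_le_add ?_ ?_)
  · rw [norm_div]
    have hb : 2 * y * (m * y) * (m * y) ≤ ‖2 * (y:ℂ) * s1 * s2‖ := by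
      simp only [norm_mul, Complex.norm_ofNat, Complex.norm_real, Real.norm_eq_abs, abs_of_pos hy0]
      gcongr
    have ht := norm_sin_sub_self_le (2 * (y:ℂ) * z)
    have him : |(2 * (y:ℂ) * z).im| = 2 * y * |z.im| := by
      have : (2 * (y:ℂ) * z).im = 2 * y * z.im := by
        have : (2 * (y:ℂ) * z) = ((2 * y : ℝ) : ℂ) * z := by push_cast; ring
        rw [this, Complex.im_ofReal_mul]
      rw [this, abs_mul, abs_of_pos (by positivity)]
    have hnorm : ‖2 * (y:ℂ) * z‖ = 2 * y * ‖z‖ := by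
      simp only [norm_mul, Complex.norm_ofNat, Complex.norm_real, Real.norm_eq_abs, abs_of_pos hy0]
    rw [him, hnorm] at ht
    calc _ ≤ (2 * (2 * y * ‖z‖) ^ 3 * Real.exp (2 * y * |z.im|)) / (2 * y * (m * y) * (m * y)) := by
          gcongr
      _ = 8 / m ^ 2 * (‖z‖ ^ 3 * Real.exp (2 * y * |z.im|)) := by
          field_simp
          ring
  · rw [norm_mul, mul_comm, norm_div, norm_neg]
    have hb : m * m * y ^ 2 * (m * y) * (m * y) ≤ ‖op * om * (y:ℂ) ^ 2 * s1 * s2‖ := by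
      simp only [norm_mul, norm_pow, Complex.norm_real, Real.norm_eq_abs, abs_of_pos hy0]
      have a1 := h1.trans (Complex.re_le_norm op)
      have a2 := h2.trans (Complex.re_le_norm om)
      gcongr
    have ht : ‖(s1 - op * y) * s2 + op * y * (s2 - om * y)‖ ≤
        D * y ^ 3 * ((D + M) * y) + M * y * (D * y ^ 3) := by
      refine (norm_add_le _ _).trans ?_
      rw [norm_mul, norm_mul (op * (y:ℂ))]
      gcongr
    refine mul_le_mul_of_nonneg_right ?_ (norm_nonneg _)
    calc _ ≤ (D * y ^ 3 * ((D + M) * y) + M * y * (D * y ^ 3)) /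
          (m * m * y ^ 2 * (m * y) * (m * y)) := by gcongr
      _ = D * (D + 2 * M) / m ^ 4 := by
          field_simp
          ring

theorem hypGammaKernel_bound_large {op om : ℂ} {m a : ℝ} (hm : 0 < m)
    (h1 : m ≤ op.re) (h2 : m ≤ om.re) (ha : 2 * a ≤ op.re + om.re) (z : ℂ) {y : ℝ}
    (hy1 : 1 ≤ y) :
    ‖hypGammaKernel op om z y‖ ≤
      2 / (1 - Real.exp (-2 * m)) ^ 2 * Real.exp (2 * y * (|z.im| - a))
        + ‖z‖ * (1 / m ^ 2 * (1 / y ^ 2)) := by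
  have hop : 0 < op.re := hm.trans_le h1
  have hom : 0 < om.re := hm.trans_le h2
  have hy0 : 0 < y := by linarith
  have hq : 0 < 1 - Real.exp (-2 * m) := by
    have : Real.exp (-2 * m) < 1 := by
      rw [← Real.exp_zero]
      exact Real.exp_lt_exp.2 (by linarith)
    linarith
  set q := 1 - Real.exp (-2 * m) with hqdef
  have re1 : (op * (y:ℂ)).re = op.re * y := by simp
  have re2 : (om * (y:ℂ)).re = om.re * y := by simp
  have l1 : q / 2 * Real.exp (op.re * y) ≤ ‖Complex.sinh (op * (y:ℂ))‖ := by
    rw [← re1]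
    exact exp_re_le_norm_sinh (by rw [re1]; nlinarith)
  have l2 : q / 2 * Real.exp (om.re * y) ≤ ‖Complex.sinh (om * (y:ℂ))‖ := by
    rw [← re2]
    exact exp_re_le_norm_sinh (by rw [re2]; nlinarith)
  have ht := norm_sin_le_exp (2 * (y:ℂ) * z)
  have him : |(2 * (y:ℂ) * z).im| = 2 * y * |z.im| := by
    have : (2 * (y:ℂ) * z).im = 2 * y * z.im := by simp
    rw [this, abs_mul, abs_of_pos (by positivity)]
  rw [him] at ht
  rw [hypGammaKernel, mul_sub]
  refine (norm_sub_le _ _).trans (add_le_add ?_ ?_)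
  · have hb : 2 * (q / 2 * Real.exp (op.re * y)) * (q / 2 * Real.exp (om.re * y)) ≤
        ‖2 * Complex.sinh (op * (y:ℂ)) * Complex.sinh (om * (y:ℂ))‖ := by
      simp only [norm_mul, Complex.norm_ofNat]
      gcongr
    have hy : ‖1 / (y:ℂ)‖ ≤ 1 := by
      rw [norm_div, norm_one, Complex.norm_real, Real.norm_eq_abs, abs_of_pos hy0]
      exact (div_le_one hy0).2 hy1
    rw [norm_mul, norm_div (Complex.sin _)]
    calc _ ≤ 1 * (Real.exp (2 * y * |z.im|) /
          (2 * (q / 2 * Real.exp (op.re * y)) * (q / 2 * Real.exp (om.re * y)))) := by gcongr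
      _ = 2 / q ^ 2 * (Real.exp (2 * y * |z.im|) / (Real.exp (op.re * y) * Real.exp (om.re * y))) := by
          field_simp
      _ ≤ 2 / q ^ 2 * Real.exp (2 * y * (|z.im| - a)) := by
          rw [← Real.exp_add, ← Real.exp_sub]
          gcongr
          nlinarith
  · have hb : m * m * y ≤ ‖op * om * (y:ℂ)‖ := by
      simp only [norm_mul, Complex.norm_real, Real.norm_eq_abs, abs_of_pos hy0]
      have a1 := h1.trans (Complex.re_le_norm op)
      have a2 := h2.trans (Complex.re_le_norm om)
      gcongr
    rw [norm_mul, norm_div, norm_div, norm_one, Complex.norm_real, Real.norm_eq_abs, abs_of_pos hy0]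
    calc _ ≤ 1 / y * (‖z‖ / (m * m * y)) := by gcongr
      _ = _ := by field_simp

/-- A bound for the kernel which is locally uniform in the quasi-periods. -/
theorem exists_hypGammaKernel_bound {m : ℝ} (M : ℝ) (hm : 0 < m) (a : ℝ) (ha : 0 ≤ a) :
    ∃ C : ℝ, 0 ≤ C ∧ ∀ op om : ℂ, m ≤ op.re → m ≤ om.re → ‖op‖ ≤ M → ‖om‖ ≤ M →
      2 * a ≤ op.re + om.re → ∀ z : ℂ, ∀ y : ℝ, 0 < y →
      ‖hypGammaKernel op om z y‖ ≤
        C * (1 + ‖z‖) ^ 3 * (Real.exp (2 * y * (|z.im| - a)) + 1 / (1 + y ^ 2)) := by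
  set D := 2 * M ^ 3 * Real.exp M with hD
  set A := 8 / m ^ 2 with hA
  set B := D * (D + 2 * M) / m ^ 4 with hB
  set q := 2 / (1 - Real.exp (-2 * m)) ^ 2 with hq
  set r := 1 / m ^ 2 with hr
  have hA0 : 0 ≤ A := by positivity
  have hq0 : 0 ≤ q := by positivity
  have hr0 : 0 ≤ r := by positivity
  refine ⟨A * Real.exp (2 * a) + 2 * |B| + q + 2 * r, by positivity, ?_⟩
  intro op om h1 h2 h3 h4 h5 z y hy
  have hz := norm_nonneg z
  have hz1 : 1 ≤ (1 + ‖z‖) ^ 3 := one_le_pow₀ (by linarith)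
  have hz2 : ‖z‖ ≤ (1 + ‖z‖) ^ 3 := by nlinarith [sq_nonneg ‖z‖, pow_nonneg hz 3]
  have hz3 : ‖z‖ ^ 3 ≤ (1 + ‖z‖) ^ 3 := by gcongr; linarith
  set Z := (1 + ‖z‖) ^ 3 with hZ
  set e := Real.exp (2 * y * (|z.im| - a)) with he
  have he0 : 0 < e := Real.exp_pos _
  set d := 1 / (1 + y ^ 2) with hd
  have hd0 : 0 < d := by positivity
  have hZ0 : 0 ≤ Z := by positivity
  rcases le_or_gt y 1 with hy1 | hy1
  · refine (hypGammaKernel_bound_small hm h1 h2 h3 h4 hD z hy hy1).trans ?_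
    have he1 : Real.exp (2 * y * |z.im|) ≤ Real.exp (2 * a) * e := by
      rw [he, ← Real.exp_add]
      refine Real.exp_le_exp.2 ?_
      nlinarith
    have hd1 : 1 ≤ 2 * d := by
      rw [hd, mul_one_div, le_div_iff₀ (by positivity)]
      nlinarith
    calc A * (‖z‖ ^ 3 * Real.exp (2 * y * |z.im|)) + B * ‖z‖
        ≤ A * (Z * (Real.exp (2 * a) * e)) + |B| * (Z * (2 * d)) := by
          have : ‖z‖ ≤ Z * (2 * d) := by nlinarith
          have := le_abs_self B
          gcongr
      _ ≤ _ := by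
          have p1 : 0 ≤ A * Real.exp (2 * a) * (Z * d) := by positivity
          have p2 : 0 ≤ |B| * (Z * e) := by positivity
          have p3 : 0 ≤ q * (Z * (e + d)) := by positivity
          have p4 : 0 ≤ r * (Z * (e + d)) := by positivity
          nlinarith
  · refine (hypGammaKernel_bound_large hm h1 h2 h5 z hy1.le).trans ?_
    have hd1 : 1 / y ^ 2 ≤ 2 * d := by
      rw [hd, mul_one_div, div_le_div_iff₀ (by positivity) (by positivity)]
      nlinarith
    calc q * e + ‖z‖ * (r * (1 / y ^ 2)) ≤ q * (Z * e) + Z * (r * (2 * d)) := by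
          have : e ≤ Z * e := by nlinarith
          gcongr
      _ ≤ _ := by
          have p1 : 0 ≤ A * Real.exp (2 * a) * (Z * (e + d)) := by positivity
          have p2 : 0 ≤ |B| * (Z * (e + d)) := by positivity
          have p3 : 0 ≤ q * (Z * d) := by positivity
          have p4 : 0 ≤ r * (Z * e) := by positivity
          nlinarith

/-! ### Integrals depending holomorphically on a parameter -/

theorem differentiableOn_integral_of_dominated {α : Type*} [MeasurableSpace α] {μ : Measure α}
    {U : Set ℂ} (hU : IsOpen U) {f : ℂ → α → ℂ}
    (hmeas : ∀ z ∈ U, AEStronglyMeasurable (f z) μ)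
    (hdiff : ∀ᵐ y ∂μ, DifferentiableOn ℂ (fun z => f z y) U)
    (hbound : ∀ z₀ ∈ U, ∃ b : α → ℝ, Integrable b μ ∧
      ∃ V ∈ 𝓝 z₀, ∀ᵐ y ∂μ, ∀ z ∈ V, ‖f z y‖ ≤ b y) :
    DifferentiableOn ℂ (fun z => ∫ y, f z y ∂μ) U := by
  intro z₀ hz₀
  obtain ⟨b, hb, V, hV, h⟩ := hbound z₀ hz₀
  obtain ⟨r, hr, hball⟩ := Metric.mem_nhds_iff.1 (inter_mem hV (hU.mem_nhds hz₀))
  have hr2 : 0 < r / 2 := by positivity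
  have hsub : ∀ z ∈ Metric.ball z₀ (r / 2), Metric.closedBall z (r / 2) ⊆ Metric.ball z₀ r := by
    intro z hz w hw
    rw [Metric.mem_ball] at *
    rw [Metric.mem_closedBall] at hw
    linarith [dist_triangle w z z₀]
  have hda : ∀ᵐ y ∂μ, ∀ z ∈ Metric.ball z₀ (r / 2),
      HasDerivAt (fun w => f w y) (deriv (fun w => f w y) z) z := by
    filter_upwards [hdiff] with y hy z hz
    have hzU : z ∈ U := (hball (hsub z hz (Metric.mem_closedBall_self hr2.le))).2
    exact (hy.differentiableAt (hU.mem_nhds hzU)).hasDerivAt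
  refine (hasDerivAt_integral_of_dominated_loc_of_deriv_le (s := Metric.ball z₀ (r / 2))
    (bound := fun y => b y / (r / 2)) (F' := fun z y => deriv (fun w => f w y) z)
    (Metric.ball_mem_nhds _ hr2) ?_ ?_ ?_ ?_ (hb.div_const _) hda).2.differentiableAt.differentiableWithinAt
  · filter_upwards [hU.mem_nhds hz₀] with z hz using hmeas z hz
  · refine Integrable.mono' hb (hmeas z₀ hz₀) ?_
    filter_upwards [h] with y hy using hy z₀ (mem_of_mem_nhds hV)
  · set u : ℕ → ℂ := fun n => ((r / 2 / (n + 1) : ℝ) : ℂ) with hu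
    have hu0 : ∀ n, u n ≠ 0 := fun n => by
      exact Complex.ofReal_ne_zero.2 (by positivity)
    have hut : Tendsto u atTop (𝓝[≠] 0) := by
      refine tendsto_nhdsWithin_iff.2 ⟨?_, Eventually.of_forall hu0⟩
      have h1 : Tendsto (fun n : ℕ => r / 2 / ((n:ℝ) + 1)) atTop (𝓝 0) :=
        tendsto_const_nhds.div_atTop (tendsto_natCast_atTop_atTop.atTop_add tendsto_const_nhds)
      exact (Complex.continuous_ofReal.tendsto 0).comp h1
    refine aestronglyMeasurable_of_tendsto_ae atTop
      (f := fun n y => (u n)⁻¹ • (f (z₀ + u n) y - f z₀ y)) (fun n => ?_) ?_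
    · have hz : z₀ + u n ∈ U := by
        refine (hball ?_).2
        rw [Metric.mem_ball, dist_eq_norm, add_sub_cancel_left, hu, Complex.norm_real,
          Real.norm_eq_abs, abs_of_pos (by positivity)]
        refine (div_le_self hr2.le ?_).trans_lt (by linarith)
        linarith [(n.cast_nonneg : (0:ℝ) ≤ n)]
      exact ((hmeas _ hz).sub (hmeas _ hz₀)).const_smul (u n)⁻¹
    · filter_upwards [hda] with y hy
      exact (hy z₀ (Metric.mem_ball_self hr2)).tendsto_slope_zero.comp hut
  · filter_upwards [h, hdiff] with y hy hd z hz
    have hs := hsub z hz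
    refine Complex.norm_deriv_le_of_forall_mem_sphere_norm_le hr2 ?_ fun w hw =>
      hy w (hball (hs (Metric.sphere_subset_closedBall hw))).1
    exact (hd.mono fun w hw => (hball (hs hw)).2).diffContOnCl_ball subset_rfl

/-! ### The logarithm of the hyperbolic gamma function on the strip -/

theorem hypGammaKernel_continuousOn {op om : ℂ} (hop : 0 < op.re) (hom : 0 < om.re) (z : ℂ) :
    ContinuousOn (hypGammaKernel op om z) (Ioi 0) := by
  have h0 : ∀ y ∈ Ioi (0:ℝ), (y : ℂ) ≠ 0 := fun y hy => by exact_mod_cast (ne_of_gt hy)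
  have hopn : op ≠ 0 := fun h => by simp [h] at hop
  have homn : om ≠ 0 := fun h => by simp [h] at hom
  have h1 : ∀ a : ℂ, 0 < a.re → ∀ y ∈ Ioi (0:ℝ), Complex.sinh (a * (y:ℂ)) ≠ 0 := by
    intro a ha y hy
    refine sinh_ne_zero_of_re_pos ?_
    simpa using mul_pos ha hy
  unfold hypGammaKernel
  refine ContinuousOn.mul (ContinuousOn.div (by fun_prop) (by fun_prop) h0)
    (ContinuousOn.sub (ContinuousOn.div (Continuous.continuousOn (by fun_prop)) (Continuous.continuousOn (by fun_prop)) fun y hy => ?_)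
      (ContinuousOn.div (by fun_prop) (by fun_prop) fun y hy => ?_))
  · exact mul_ne_zero (mul_ne_zero two_ne_zero (h1 op hop y hy)) (h1 om hom y hy)
  · exact mul_ne_zero (mul_ne_zero hopn homn) (h0 y hy)

theorem hypGammaKernel_aestronglyMeasurable {op om : ℂ} (hop : 0 < op.re) (hom : 0 < om.re)
    (z : ℂ) : AEStronglyMeasurable (hypGammaKernel op om z) (volume.restrict (Ioi 0)) :=
  (hypGammaKernel_continuousOn hop hom z).aestronglyMeasurable measurableSet_Ioi

theorem hypGammaKernel_continuousAt {op om : ℂ} (hop : 0 < op.re) (hom : 0 < om.re) (z : ℂ)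
    {y : ℝ} (hy : 0 < y) :
    ContinuousAt (fun q : ℂ × ℂ => hypGammaKernel q.1 om q.2 y) (op, z) := by
  have h0 : (y : ℂ) ≠ 0 := by exact_mod_cast (ne_of_gt hy)
  have hopn : op ≠ 0 := fun h => by simp [h] at hop
  have homn : om ≠ 0 := fun h => by simp [h] at hom
  have h1 : ∀ a : ℂ, 0 < a.re → Complex.sinh (a * (y:ℂ)) ≠ 0 := by
    intro a ha
    refine sinh_ne_zero_of_re_pos ?_
    simpa using mul_pos ha hy
  have h2 := h1 op hop
  have h3 := h1 om hom
  unfold hypGammaKernel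
  refine ContinuousAt.mul continuousAt_const
    (ContinuousAt.sub (ContinuousAt.div (Continuous.continuousAt (by fun_prop))
        (Continuous.continuousAt (by fun_prop)) ?_)
      (ContinuousAt.div (by fun_prop) (by fun_prop) ?_))
  · exact mul_ne_zero (mul_ne_zero two_ne_zero h2) h3
  · exact mul_ne_zero (mul_ne_zero hopn homn) h0

theorem hypGammaKernel_differentiable (op om : ℂ) (y : ℝ) :
    Differentiable ℂ (fun z => hypGammaKernel op om z y) := by
  unfold hypGammaKernel
  simp only [div_eq_mul_inv]
  have : Differentiable ℂ (fun z : ℂ => Complex.sin (2 * (y:ℂ) * z)) :=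
    Complex.differentiable_sin.comp (by fun_prop)
  fun_prop

theorem hypGammaKernel_neg (op om z : ℂ) (y : ℝ) :
    hypGammaKernel op om (-z) y = -hypGammaKernel op om z y := by
  simp only [hypGammaKernel, mul_neg, Complex.sin_neg]
  ring

theorem hypGammaKernel_comm (op om z : ℂ) (y : ℝ) :
    hypGammaKernel op om z y = hypGammaKernel om op z y := by
  simp only [hypGammaKernel]
  ring

theorem integrableOn_majorant {c : ℝ} (hc : c < 0) :
    IntegrableOn (fun y : ℝ => Real.exp (2 * y * c) + 1 / (1 + y ^ 2)) (Ioi 0) := by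
  refine Integrable.add ?_ ?_
  · have h := integrableOn_exp_mul_Ioi (a := 2 * c) (by linarith) 0
    refine h.congr_fun (fun y _ => ?_) measurableSet_Ioi
    ring_nf
  · simpa using integrable_inv_one_add_sq.restrict

/-- Local domination of the kernel, jointly in one quasi-period and the argument. -/
theorem hypGammaKernel_dominated {op om z : ℂ} (hop : 0 < op.re) (hom : 0 < om.re)
    (hz : |z.im| < ((op + om) / 2).re) :
    ∃ b : ℝ → ℝ, IntegrableOn b (Ioi 0) ∧ ∀ᶠ q : ℂ × ℂ in 𝓝 (op, z),
      ∀ y : ℝ, 0 < y → ‖hypGammaKernel q.1 om q.2 y‖ ≤ b y := by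
  have hz' : |z.im| < (op.re + om.re) / 2 := by simpa using hz
  obtain ⟨c, hc1, hc2⟩ := exists_between hz'
  obtain ⟨a, ha1, ha2⟩ := exists_between hc2
  have ha0 : 0 ≤ a := (abs_nonneg _).trans (hc1.trans ha1).le
  set m := min (op.re / 2) om.re with hm
  set M := max (‖op‖ + 1) ‖om‖ with hM
  have hm0 : 0 < m := lt_min (by linarith) hom
  obtain ⟨C, hC, hb⟩ := exists_hypGammaKernel_bound M hm0 a ha0
  refine ⟨fun y => C * (1 + (‖z‖ + 1)) ^ 3 * (Real.exp (2 * y * (c - a)) + 1 / (1 + y ^ 2)),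
    (integrableOn_majorant (by linarith)).const_mul _, ?_⟩
  have cfst : Continuous fun q : ℂ × ℂ => q.1.re := by fun_prop
  have cnorm : Continuous fun q : ℂ × ℂ => ‖q.1‖ := by fun_prop
  have cim : Continuous fun q : ℂ × ℂ => |q.2.im| := by fun_prop
  have cz : Continuous fun q : ℂ × ℂ => ‖q.2‖ := by fun_prop
  have e1 : ∀ᶠ q : ℂ × ℂ in 𝓝 (op, z), max (op.re / 2) (2 * a - om.re) < q.1.re :=
    cfst.continuousAt.eventually (lt_mem_nhds (max_lt (by linarith) (by simp only []; linarith)))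
  have e2 : ∀ᶠ q : ℂ × ℂ in 𝓝 (op, z), ‖q.1‖ < ‖op‖ + 1 :=
    cnorm.continuousAt.eventually (gt_mem_nhds (by simp))
  have e3 : ∀ᶠ q : ℂ × ℂ in 𝓝 (op, z), |q.2.im| < c :=
    cim.continuousAt.eventually (gt_mem_nhds hc1)
  have e4 : ∀ᶠ q : ℂ × ℂ in 𝓝 (op, z), ‖q.2‖ < ‖z‖ + 1 :=
    cz.continuousAt.eventually (gt_mem_nhds (by simp))
  filter_upwards [e1, e2, e3, e4] with q h1 h2 h3 h4 y hy
  have h1a := (le_max_left _ _).trans_lt h1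
  have h1b := (le_max_right _ _).trans_lt h1
  refine (hb q.1 om ((min_le_left _ _).trans h1a.le) (min_le_right _ _)
    (h2.le.trans (le_max_left _ _)) (le_max_right _ _) (by linarith) q.2 y hy).trans ?_
  gcongr

theorem hypGammaKernel_integrable {op om z : ℂ} (hop : 0 < op.re) (hom : 0 < om.re)
    (hz : |z.im| < ((op + om) / 2).re) : IntegrableOn (hypGammaKernel op om z) (Ioi 0) := by
  obtain ⟨b, hb, h⟩ := hypGammaKernel_dominated hop hom hz
  refine Integrable.mono' hb (hypGammaKernel_aestronglyMeasurable hop hom z) ?_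
  refine (ae_restrict_iff' measurableSet_Ioi).2 (Eventually.of_forall fun y hy => ?_)
  exact h.self_of_nhds y hy

theorem hypGammaInt_eq (op om z : ℂ) :
    hypGammaInt op om z = Complex.exp (I * ∫ y in Ioi (0:ℝ), hypGammaKernel op om z y) := rfl

theorem hypGammaInt_comm (op om z : ℂ) : hypGammaInt op om z = hypGammaInt om op z := by
  simp only [hypGammaInt_eq, hypGammaKernel_comm op om]

theorem hypGammaInt_zero (op om : ℂ) : hypGammaInt op om 0 = 1 := by
  simp [hypGammaInt_eq, hypGammaKernel]

theorem hypGammaInt_mul_neg (op om z : ℂ) : hypGammaInt op om z * hypGammaInt op om (-z) = 1 := by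
  simp only [hypGammaInt_eq, hypGammaKernel_neg, integral_neg]
  rw [← Complex.exp_add, mul_neg, add_neg_cancel, Complex.exp_zero]

theorem hypGammaInt_continuousAt {op om z : ℂ} (hop : 0 < op.re) (hom : 0 < om.re)
    (hz : |z.im| < ((op + om) / 2).re) :
    ContinuousAt (fun q : ℂ × ℂ => hypGammaInt q.1 om q.2) (op, z) := by
  simp only [hypGammaInt_eq]
  obtain ⟨b, hb, h⟩ := hypGammaKernel_dominated hop hom hz
  have hre : ∀ᶠ q : ℂ × ℂ in 𝓝 (op, z), 0 < q.1.re := by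
    have : Continuous fun q : ℂ × ℂ => q.1.re := by fun_prop
    exact this.continuousAt.eventually (lt_mem_nhds hop)
  have hc : ContinuousAt (fun q : ℂ × ℂ => ∫ y in Ioi (0:ℝ), hypGammaKernel q.1 om q.2 y) (op, z) := by
    refine continuousAt_of_dominated (bound := b) ?_ ?_ hb ?_
    · filter_upwards [hre] with q hq using hypGammaKernel_aestronglyMeasurable hq hom _
    · filter_upwards [h] with q hq
      exact (ae_restrict_iff' measurableSet_Ioi).2 (Eventually.of_forall fun y hy => hq y hy)
    · exact (ae_restrict_iff' measurableSet_Ioi).2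
        (Eventually.of_forall fun y hy => hypGammaKernel_continuousAt hop hom z hy)
  exact (Complex.continuous_exp.continuousAt).comp (continuousAt_const.mul hc)

theorem hypGammaInt_differentiableOn {op om : ℂ} (hop : 0 < op.re) (hom : 0 < om.re) :
    DifferentiableOn ℂ (hypGammaInt op om) {z | |z.im| < ((op + om) / 2).re} := by
  have hopen : IsOpen {z : ℂ | |z.im| < ((op + om) / 2).re} :=
    isOpen_lt (by fun_prop) continuous_const
  have : DifferentiableOn ℂ (fun z => ∫ y in Ioi (0:ℝ), hypGammaKernel op om z y)
      {z | |z.im| < ((op + om) / 2).re} := by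
    refine differentiableOn_integral_of_dominated hopen
      (fun z _ => hypGammaKernel_aestronglyMeasurable hop hom z)
      (Eventually.of_forall fun y => (hypGammaKernel_differentiable op om y).differentiableOn)
      fun z hz => ?_
    obtain ⟨b, hb, h⟩ := hypGammaKernel_dominated hop hom hz
    have ht : Tendsto (fun w : ℂ => (op, w)) (𝓝 z) (𝓝 (op, z)) := by
      exact (Continuous.prodMk continuous_const continuous_id).tendsto z
    refine ⟨b, hb, _, ht.eventually h, ?_⟩
    exact (ae_restrict_iff' measurableSet_Ioi).2 (Eventually.of_forall fun y hy w hw => hw y hy)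
  exact (this.const_mul I).cexp

/-- Growth of the hyperbolic gamma function on closed substrips of the strip of convergence. -/
theorem hypGammaInt_growth {op om : ℂ} (hop : 0 < op.re) (hom : 0 < om.re) {c : ℝ}
    (hc : c < ((op + om) / 2).re) :
    ∃ C : ℝ, 0 ≤ C ∧ ∀ z : ℂ, |z.im| ≤ c →
      ‖hypGammaInt op om z‖ ≤ Real.exp (C * (1 + ‖z‖) ^ 3) := by
  rcases lt_or_ge c 0 with hc0 | hc0
  · exact ⟨0, le_rfl, fun z hz => absurd (hz.trans_lt hc0) (not_lt.2 (abs_nonneg _))⟩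
  have hre : ((op + om) / 2).re = (op.re + om.re) / 2 := by simp
  rw [hre] at hc
  obtain ⟨a, ha1, ha2⟩ := exists_between hc
  obtain ⟨C, hC, hb⟩ := exists_hypGammaKernel_bound (max ‖op‖ ‖om‖) (lt_min hop hom) a
    (hc0.trans ha1.le)
  have hi := integrableOn_majorant (c := c - a) (by linarith)
  set J := ∫ y in Ioi (0:ℝ), (Real.exp (2 * y * (c - a)) + 1 / (1 + y ^ 2)) with hJ
  have hJ0 : 0 ≤ J := integral_nonneg fun y => by positivity
  refine ⟨C * J, by positivity, fun z hz => ?_⟩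
  rw [hypGammaInt_eq, Complex.norm_exp]
  refine Real.exp_le_exp.2 ((Complex.re_le_norm _).trans ?_)
  rw [norm_mul, Complex.norm_I, one_mul]
  have : C * J * (1 + ‖z‖) ^ 3 =
      ∫ y in Ioi (0:ℝ), C * (1 + ‖z‖) ^ 3 * (Real.exp (2 * y * (c - a)) + 1 / (1 + y ^ 2)) := by
    rw [integral_const_mul]; ring
  rw [this]
  refine norm_integral_le_of_norm_le (hi.const_mul _) ?_
  refine (ae_restrict_iff' measurableSet_Ioi).2 (Eventually.of_forall fun y hy => ?_)
  refine (hb op om (min_le_left _ _) (min_le_right _ _) (le_max_left _ _) (le_max_right _ _)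
    (by linarith) z y hy).trans ?_
  have : 0 < y := hy
  gcongr

/-! ### The functional equations and their immediate consequences -/

theorem isOpen_im_gt (c : ℝ) : IsOpen {z : ℂ | c < z.im} :=
  isOpen_lt continuous_const Complex.continuous_im

theorem IsHypGamma.symm {op om : ℂ} {G : ℂ → ℂ} (h : IsHypGamma op om G) :
    IsHypGamma om op G where
  strip z hz := by rw [h.strip z (by rwa [add_comm]), hypGammaInt_comm]
  funEqm := h.funEqp
  funEqp := h.funEqm
  cont := by
    have : hypGammaPoles om op = hypGammaPoles op om := by
      ext z
      constructor <;> rintro ⟨m, n, rfl⟩ <;> exact ⟨n, m, by ring⟩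
    rw [this]
    exact h.cont

theorem notMem_hypGammaPoles {op om z : ℂ} (hop : 0 < op.re) (hom : 0 < om.re)
    (hz : -((op + om) / 2).re < z.im) : z ∉ hypGammaPoles op om := by
  rintro ⟨m, n, rfl⟩
  have h1 : 0 ≤ (m:ℝ) * op.re := by positivity
  have h2 : 0 ≤ (n:ℝ) * om.re := by positivity
  have e : (-I * (op + om) / 2 - (m:ℂ) * I * op - (n:ℂ) * I * om).im
      = -((op + om) / 2).re - m * op.re - n * om.re := by
    simp
    ring
  rw [e] at hz
  linarith

theorem IsHypGamma.continuousAt {op om : ℂ} {G : ℂ → ℂ} (h : IsHypGamma op om G)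
    (hop : 0 < op.re) (hom : 0 < om.re) {z : ℂ} (hz : -((op + om) / 2).re < z.im) :
    ContinuousAt G z := by
  have h1 : ContinuousOn G {z | -((op + om) / 2).re < z.im} :=
    h.cont.mono fun z hz => notMem_hypGammaPoles hop hom hz
  exact h1.continuousAt ((isOpen_im_gt _).mem_nhds hz)

theorem eventually_cosh_ne_zero {op : ℂ} (hop : op ≠ 0) (b z : ℂ) :
    ∀ᶠ w in 𝓝[≠] z, Complex.cosh (Real.pi * (w + b) / op) ≠ 0 := by
  have hd : HasDerivAt (fun w => Complex.cosh (Real.pi * (w + b) / op))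
      (Complex.sinh (Real.pi * (z + b) / op) * (Real.pi * 1 / op)) z :=
    ((((hasDerivAt_id z).add_const b).const_mul (Real.pi : ℂ)).div_const op).ccosh
  by_cases h : Complex.cosh (Real.pi * (z + b) / op) = 0
  · have hs : Complex.sinh (Real.pi * (z + b) / op) ≠ 0 := fun hs => by
      have := Complex.cosh_sq_sub_sinh_sq (Real.pi * (z + b) / op)
      rw [h, hs] at this
      norm_num at this
    exact hd.eventually_ne (mul_ne_zero hs (div_ne_zero (by simp) hop))
  · exact (hd.continuousAt.eventually_ne h).filter_mono nhdsWithin_le_nhds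

theorem IsHypGamma.add_om {op om : ℂ} {G : ℂ → ℂ} (h : IsHypGamma op om G)
    (hop : 0 < op.re) (hom : 0 < om.re) {z : ℂ} (hz : -((op + om) / 2).re < z.im) :
    G (z + I * om) = 2 * Complex.cosh (Real.pi * (z + I * om / 2) / op) * G z := by
  have hopn : op ≠ 0 := fun h => by simp [h] at hop
  have hz2 : -((op + om) / 2).re < (z + I * om).im := by
    simp only [Complex.add_im, Complex.mul_im, Complex.I_re, Complex.I_im]
    linarith
  have c1 : Tendsto (fun w => G (w + I * om)) (𝓝 z) (𝓝 (G (z + I * om))) :=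
    (h.continuousAt hop hom hz2).tendsto.comp
      (Continuous.tendsto (by fun_prop : Continuous fun w : ℂ => w + I * om) z)
  have c2 : Tendsto (fun w => 2 * Complex.cosh (Real.pi * (w + I * om / 2) / op) * G w) (𝓝 z)
      (𝓝 (2 * Complex.cosh (Real.pi * (z + I * om / 2) / op) * G z)) :=
    ((Continuous.tendsto (by fun_prop :
      Continuous fun w : ℂ => 2 * Complex.cosh (Real.pi * (w + I * om / 2) / op)) z)).mul
      (h.continuousAt hop hom hz).tendsto
  have c1' := c1.mono_left (nhdsWithin_le_nhds (s := {z}ᶜ))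
  have c2' := c2.mono_left (nhdsWithin_le_nhds (s := {z}ᶜ))
  refine tendsto_nhds_unique_of_eventuallyEq c1' c2' ?_
  filter_upwards [eventually_cosh_ne_zero hopn (I * om / 2) z] with w hw
  have := h.funEqm (w + I * om / 2) hw
  rw [← sub_eq_zero] at this ⊢
  rw [← this]
  ring_nf

theorem IsHypGamma.add_op {op om : ℂ} {G : ℂ → ℂ} (h : IsHypGamma op om G)
    (hop : 0 < op.re) (hom : 0 < om.re) {z : ℂ} (hz : -((op + om) / 2).re < z.im) :
    G (z + I * op) = 2 * Complex.cosh (Real.pi * (z + I * op / 2) / om) * G z :=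
  h.symm.add_om hom hop (by rwa [add_comm])

theorem IsHypGamma.zero {op om : ℂ} {G : ℂ → ℂ} (h : IsHypGamma op om G)
    (hop : 0 < op.re) (hom : 0 < om.re) : G 0 = 1 := by
  rw [h.strip 0 (by simp; linarith), hypGammaInt_zero]

/-- The half plane above the first pole is exhausted by shifting the basic strip. -/
theorem halfPlane_induction {op om : ℂ} (hop : 0 < op.re) (hom : 0 < om.re) {P : ℂ → Prop}
    (h0 : ∀ z : ℂ, |z.im| < ((op + om) / 2).re → P z)
    (h1 : ∀ z : ℂ, -((op + om) / 2).re < z.im → ((op + om) / 2).re ≤ (z + I * om).im → P z →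
      P (z + I * om))
    {z : ℂ} (hz : -((op + om) / 2).re < z.im) : P z := by
  have key : ∀ n : ℕ, ∀ z : ℂ, -((op + om) / 2).re < z.im →
      z.im < ((op + om) / 2).re + n * om.re → P z := by
    intro n
    induction n with
    | zero => exact fun z hz1 hz2 => h0 z (abs_lt.2 ⟨hz1, by simpa using hz2⟩)
    | succ n ih =>
      intro z hz1 hz2
      rcases lt_or_ge z.im ((op + om) / 2).re with hlt | hge
      · exact h0 z (abs_lt.2 ⟨hz1, hlt⟩)
      have e : z = (z - I * om) + I * om := by ring
      have him : (z - I * om).im = z.im - om.re := by simp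
      have hre : ((op + om) / 2).re = (op.re + om.re) / 2 := by simp
      push_cast at hz2
      rw [e]
      have hlow : -((op + om) / 2).re < (z - I * om).im := by rw [him]; linarith
      refine h1 _ hlow (by rw [← e]; exact hge) (ih _ hlow ?_)
      rw [him]; linarith
  obtain ⟨n, hn⟩ := exists_nat_gt ((z.im - ((op + om) / 2).re) / om.re)
  rw [div_lt_iff₀ hom] at hn
  exact key n z hz (by linarith)

theorem IsHypGamma.reflection_of_strip {op om : ℂ} {G : ℂ → ℂ} (h : IsHypGamma op om G) {z : ℂ}
    (hz : |z.im| < ((op + om) / 2).re) : G z * G (-z) = 1 := by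
  rw [h.strip z hz, h.strip (-z) (by simpa using hz), hypGammaInt_mul_neg]

theorem cosh_eq_zero {z : ℂ} (hz : Complex.cosh z = 0) :
    ∃ j : ℤ, z = I * Real.pi * (j + 1 / 2) := by
  rw [← Complex.cos_mul_I, Complex.cos_eq_zero_iff] at hz
  obtain ⟨j, hj⟩ := hz
  refine ⟨-j - 1, ?_⟩
  have : z = -I * (z * I) := by linear_combination z * Complex.I_mul_I
  rw [this, hj]
  push_cast
  ring

/-- The reflection equation away from the zeros. -/
theorem IsHypGamma.reflection {op om : ℂ} {G : ℂ → ℂ} (h : IsHypGamma op om G)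
    (hop : 0 < op.re) (hom : 0 < om.re) {z : ℂ} (hz : -((op + om) / 2).re < z.im)
    (hz' : ∀ m n : ℕ, z ≠ I * ((op + om) / 2 + m * op + n * om)) : G z * G (-z) = 1 := by
  have hopn : op ≠ 0 := fun h => by simp [h] at hop
  have hpi : (Real.pi : ℂ) ≠ 0 := by exact_mod_cast Real.pi_ne_zero
  revert hz'
  refine halfPlane_induction hop hom (P := fun z =>
    (∀ m n : ℕ, z ≠ I * ((op + om) / 2 + m * op + n * om)) → G z * G (-z) = 1)
    (fun z hz _ => h.reflection_of_strip hz) (fun z hz1 hz2 ih hz' => ?_) hz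
  have ih' := ih fun m n e => hz' m (n + 1) (by rw [e]; push_cast; ring)
  have hc : Complex.cosh (Real.pi * (z + I * om / 2) / op) ≠ 0 := by
    intro hc
    obtain ⟨j, hj⟩ := cosh_eq_zero hc
    have e : z + I * om = I * ((op + om) / 2 + j * op) := by
      rw [div_eq_iff hopn] at hj
      have : (Real.pi : ℂ) * (z + I * om) = Real.pi * (I * ((op + om) / 2 + j * op)) := by
        linear_combination hj
      exact mul_left_cancel₀ hpi this
    have hj0 : 0 ≤ j := by
      rw [e] at hz2
      have : (I * ((op + om) / 2 + (j:ℂ) * op)).im = ((op + om) / 2).re + j * op.re := by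
        simp
      rw [this] at hz2
      have : 0 ≤ (j:ℝ) * op.re := by linarith
      exact_mod_cast nonneg_of_mul_nonneg_left this hop
    obtain ⟨m, rfl⟩ := Int.eq_ofNat_of_zero_le hj0
    exact hz' m 0 (by rw [e]; push_cast; ring)
  have e1 := h.add_om hop hom hz1
  have e2 := h.funEqm (-(z + I * om / 2))
    (by rw [mul_neg, neg_div, Complex.cosh_neg]; exact hc)
  rw [mul_neg, neg_div, Complex.cosh_neg, show -(z + I * om / 2) + I * om / 2 = -z by ring,
    show -(z + I * om / 2) - I * om / 2 = -(z + I * om) by ring] at e2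
  rw [e1, ← ih', e2]
  ring

theorem IsHypGamma.differentiableAt {op om : ℂ} {G : ℂ → ℂ} (h : IsHypGamma op om G)
    (hop : 0 < op.re) (hom : 0 < om.re) {z : ℂ} (hz : -((op + om) / 2).re < z.im) :
    DifferentiableAt ℂ G z := by
  refine halfPlane_induction hop hom (P := fun z => DifferentiableAt ℂ G z)
    (fun z hz => ?_) (fun z hz1 _ ih => ?_) hz
  · have hopen : IsOpen {z : ℂ | |z.im| < ((op + om) / 2).re} :=
      isOpen_lt (by fun_prop) continuous_const
    refine ((hypGammaInt_differentiableOn hop hom).differentiableAt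
      (hopen.mem_nhds hz)).congr_of_eventuallyEq ?_
    filter_upwards [hopen.mem_nhds hz] with w hw using h.strip w hw
  · have hd : DifferentiableAt ℂ (fun w =>
        2 * Complex.cosh (Real.pi * (w - I * om + I * om / 2) / op) * G (w - I * om))
        (z + I * om) := by
      have h1 : DifferentiableAt ℂ (fun w => G (w - I * om)) (z + I * om) :=
        DifferentiableAt.comp (g := G) (f := fun w => w - I * om) _ (by simpa using ih)
          (by fun_prop)
      have h2 : Differentiable ℂ (fun w : ℂ =>
          2 * Complex.cosh (Real.pi * (w - I * om + I * om / 2) / op)) := by fun_prop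
      exact (h2 _).mul h1
    refine hd.congr_of_eventuallyEq ?_
    have : ∀ᶠ w in 𝓝 (z + I * om), -((op + om) / 2).re < (w - I * om).im :=
      (Continuous.continuousAt (by fun_prop : Continuous fun w : ℂ => (w - I * om).im)).eventually
        (lt_mem_nhds (by simpa using hz1))
    filter_upwards [this] with w hw
    rw [← h.add_om hop hom hw, sub_add_cancel]

theorem continuousAt_hypGamma_family {G : ℂ → ℂ → ℂ → ℂ}
    (hG : ∀ a b : ℂ, 0 < a.re → 0 < b.re → IsHypGamma a b (G a b)) {op om : ℂ}
    (hop : 0 < op.re) (hom : 0 < om.re) {z : ℂ} (hz : -((op + om) / 2).re < z.im) :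
    ContinuousAt (fun q : ℂ × ℂ => G q.1 om q.2) (op, z) := by
  have hre : ∀ z, ∀ᶠ q : ℂ × ℂ in 𝓝 (op, z), 0 < q.1.re := fun z =>
    (Continuous.continuousAt (by fun_prop : Continuous fun q : ℂ × ℂ => q.1.re)).eventually
      (lt_mem_nhds hop)
  refine halfPlane_induction hop hom
    (P := fun z => ContinuousAt (fun q : ℂ × ℂ => G q.1 om q.2) (op, z))
    (fun z hz => ?_) (fun z hz1 _ ih => ?_) hz
  · refine (hypGammaInt_continuousAt hop hom hz).congr ?_
    have : ∀ᶠ q : ℂ × ℂ in 𝓝 (op, z), |q.2.im| < ((q.1 + om) / 2).re := by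
      have h1 : IsOpen {q : ℂ × ℂ | |q.2.im| < ((q.1 + om) / 2).re} := by
        refine isOpen_lt (by fun_prop) ?_
        exact Complex.continuous_re.comp (by fun_prop)
      exact h1.mem_nhds hz
    filter_upwards [this, hre z] with q hq hq1
    exact ((hG q.1 om hq1 hom).strip _ hq).symm
  · have hd : ContinuousAt (fun q : ℂ × ℂ =>
        2 * Complex.cosh (Real.pi * (q.2 - I * om + I * om / 2) / q.1) * G q.1 om (q.2 - I * om))
        (op, z + I * om) := by
      have h1 : ContinuousAt (fun q : ℂ × ℂ => G q.1 om (q.2 - I * om)) (op, z + I * om) :=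
        ContinuousAt.comp (g := fun q : ℂ × ℂ => G q.1 om q.2)
          (f := fun q : ℂ × ℂ => (q.1, q.2 - I * om)) (by simpa using ih) (by fun_prop)
      have hopn : op ≠ 0 := fun h => by simp [h] at hop
      have h2 : ContinuousAt (fun q : ℂ × ℂ =>
          2 * Complex.cosh (Real.pi * (q.2 - I * om + I * om / 2) / q.1)) (op, z + I * om) := by
        refine continuousAt_const.mul ?_
        refine Complex.continuous_cosh.continuousAt.comp ?_
        exact ContinuousAt.div (by fun_prop) (by fun_prop) hopn
      exact h2.mul h1
    refine hd.congr ?_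
    have h1 : IsOpen {q : ℂ × ℂ | -((q.1 + om) / 2).re < (q.2 - I * om).im} := by
      refine isOpen_lt ?_ (Complex.continuous_im.comp (by fun_prop))
      exact (Complex.continuous_re.comp (by fun_prop)).neg
    filter_upwards [h1.mem_nhds (by simpa only [Set.mem_ofPred_eq, add_sub_cancel_right] using hz1), hre _] with q hq hq1
    rw [← (hG q.1 om hq1 hom).add_om hq1 hom hq, sub_add_cancel]

/-- Growth in closed horizontal strips above the first pole. -/
theorem IsHypGamma.growth {op om : ℂ} {G : ℂ → ℂ} (h : IsHypGamma op om G)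
    (hop : 0 < op.re) (hom : 0 < om.re) {c : ℝ} (hc : -((op + om) / 2).re < c) (M : ℝ) :
    ∃ C : ℝ, 0 ≤ C ∧ ∀ z : ℂ, c ≤ z.im → z.im ≤ M →
      ‖G z‖ ≤ Real.exp (C * (1 + ‖z‖) ^ 3) := by
  have hre : ((op + om) / 2).re = (op.re + om.re) / 2 := by simp
  obtain ⟨δ, hδ0, hδ1, hδ2⟩ : ∃ δ : ℝ, 0 < δ ∧ δ ≤ op.re / 2 ∧ -((op + om) / 2).re + δ ≤ c :=
    ⟨min (op.re / 2) (c + ((op + om) / 2).re), lt_min (by linarith) (by linarith),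
      min_le_left _ _, by linarith [min_le_right (op.re / 2) (c + ((op + om) / 2).re)]⟩
  have key : ∀ n : ℕ, ∃ C : ℝ, 0 ≤ C ∧ ∀ z : ℂ, -((op + om) / 2).re + δ ≤ z.im →
      z.im ≤ ((op + om) / 2).re - δ + n * om.re → ‖G z‖ ≤ Real.exp (C * (1 + ‖z‖) ^ 3) := by
    intro n
    induction n with
    | zero =>
      obtain ⟨C, hC, hb⟩ := hypGammaInt_growth hop hom
        (show ((op + om) / 2).re - δ < ((op + om) / 2).re by linarith)
      refine ⟨C, hC, fun z hz1 hz2 => ?_⟩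
      have : |z.im| ≤ ((op + om) / 2).re - δ := abs_le.2 ⟨by linarith, by simpa using hz2⟩
      rw [h.strip z (by linarith)]
      exact hb z this
    | succ n ih =>
      obtain ⟨C, hC, hb⟩ := ih
      set A : ℝ := Real.pi * (1 + ‖om‖) / ‖op‖ with hA
      have hA0 : 0 ≤ A := by positivity
      refine ⟨1 + A + C * (1 + ‖om‖) ^ 3, by positivity, fun z hz1 hz2 => ?_⟩
      have hz0 : 1 ≤ 1 + ‖z‖ := by linarith [norm_nonneg z]
      have ho0 : 1 ≤ 1 + ‖om‖ := by linarith [norm_nonneg om]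
      rcases le_or_gt z.im (((op + om) / 2).re - δ + n * om.re) with hle | hgt
      · refine (hb z hz1 hle).trans (Real.exp_le_exp.2 ?_)
        gcongr
        nlinarith [one_le_pow₀ ho0 (n := 3)]
      set w := z - I * om with hw
      have him : w.im = z.im - om.re := by simp [hw]
      have e : z = w + I * om := by rw [hw]; ring
      have hn0 : 0 ≤ (n:ℝ) * om.re := by positivity
      push_cast at hz2
      have h1 := hb w (by rw [him]; linarith) (by rw [him]; linarith)
      have hwn : 1 + ‖w‖ ≤ (1 + ‖om‖) * (1 + ‖z‖) := by
        have : ‖w‖ ≤ ‖z‖ + ‖om‖ := by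
          refine (norm_sub_le _ _).trans ?_
          simp
        nlinarith [norm_nonneg z, norm_nonneg om]
      have h2 : ‖Complex.cosh (Real.pi * (w + I * om / 2) / op)‖ ≤
          Real.exp (A * (1 + ‖z‖)) := by
        refine (norm_cosh_le_exp _).trans (Real.exp_le_exp.2 ?_)
        refine (Complex.abs_re_le_norm _).trans ?_
        rw [show w + I * om / 2 = z - I * om / 2 by rw [hw]; ring, norm_div, norm_mul,
          Complex.norm_real, Real.norm_eq_abs, abs_of_pos Real.pi_pos, hA, div_mul_eq_mul_div]
        have : ‖z - I * om / 2‖ ≤ ‖z‖ + ‖om‖ := by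
          refine (norm_sub_le _ _).trans ?_
          simp
        rw [mul_assoc]
        have h0 : ‖z - I * om / 2‖ ≤ (1 + ‖om‖) * (1 + ‖z‖) := by
          nlinarith [mul_nonneg (norm_nonneg z) (norm_nonneg om)]
        gcongr
      rw [e, h.add_om hop hom (by rw [him]; linarith), ← e, norm_mul, norm_mul]
      have h3 : ‖(2:ℂ)‖ ≤ Real.exp 1 := by
        simp only [Complex.norm_ofNat]
        linarith [Real.add_one_le_exp 1]
      calc ‖(2:ℂ)‖ * ‖Complex.cosh (Real.pi * (w + I * om / 2) / op)‖ * ‖G w‖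
          ≤ Real.exp 1 * Real.exp (A * (1 + ‖z‖)) * Real.exp (C * (1 + ‖w‖) ^ 3) := by
            gcongr
        _ = Real.exp (1 + A * (1 + ‖z‖) + C * (1 + ‖w‖) ^ 3) := by
            rw [Real.exp_add, Real.exp_add]
        _ ≤ _ := by
            refine Real.exp_le_exp.2 ?_
            have h4 : 1 + ‖z‖ ≤ (1 + ‖z‖) ^ 3 := by nlinarith [mul_nonneg (norm_nonneg z) (norm_nonneg z), norm_nonneg z, pow_nonneg (norm_nonneg z) 3]
            have h5 : (1 + ‖w‖) ^ 3 ≤ (1 + ‖om‖) ^ 3 * (1 + ‖z‖) ^ 3 := by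
              rw [← mul_pow]
              gcongr
            have h6 : A * (1 + ‖z‖) ≤ A * (1 + ‖z‖) ^ 3 := by gcongr
            have h7 := mul_le_mul_of_nonneg_left h5 hC
            linarith
  obtain ⟨n, hn⟩ := exists_nat_gt ((M - ((op + om) / 2).re + δ) / om.re)
  rw [div_lt_iff₀ hom] at hn
  obtain ⟨C, hC, hb⟩ := key n
  exact ⟨C, hC, fun z h1 h2 => hb z (by linarith) (by linarith)⟩

/-! ### The pair product `G(x+z)G(-x+z)` on the real line -/

/-- The even function `x ↦ G(x+z)G(-x+z)`. -/
def hypPair (G : ℂ → ℂ) (z x : ℂ) : ℂ := G (x + z) * G (-x + z)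

theorem one_sub_cos_div_sq_bound (y : ℝ) : ‖(1 - Real.cos (2 * y)) / y ^ 2‖ ≤ 4 * (1 + y ^ 2)⁻¹ := by
  have h0 : 0 ≤ 1 - Real.cos (2 * y) := by linarith [Real.cos_le_one (2 * y)]
  have h1 : 1 - Real.cos (2 * y) ≤ 2 * y ^ 2 := by
    have := Real.one_sub_sq_div_two_le_cos (x := 2 * y)
    nlinarith
  have h2 : 1 - Real.cos (2 * y) ≤ 2 := by linarith [Real.neg_one_le_cos (2 * y)]
  rw [Real.norm_of_nonneg (by positivity)]
  rcases eq_or_ne y 0 with rfl | hy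
  · simp
  have hy2 : 0 < y ^ 2 := by positivity
  rw [div_le_iff₀ hy2, ← div_eq_mul_inv, div_mul_eq_mul_div, le_div_iff₀ (by positivity)]
  nlinarith

theorem integrable_one_sub_cos_div_sq :
    Integrable (fun y : ℝ => (1 - Real.cos (2 * y)) / y ^ 2) := by
  refine Integrable.mono' (integrable_inv_one_add_sq.const_mul 4) ?_
    (Eventually.of_forall one_sub_cos_div_sq_bound)
  exact (by fun_prop : Measurable fun y : ℝ => (1 - Real.cos (2 * y)) / y ^ 2).aestronglyMeasurable

/-- The Dirichlet-type constant `∫₀^∞ (1 - cos 2y)/y² dy`, evaluated in `dirichletConst_eq_pi`. -/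
def dirichletConst : ℝ := ∫ y in Ioi (0:ℝ), (1 - Real.cos (2 * y)) / y ^ 2

theorem one_sub_cos_scaled (x y : ℝ) :
    (1 - Real.cos (2 * y * x)) / y ^ 2
      = |x| ^ 2 * ((1 - Real.cos (2 * (|x| * y))) / (|x| * y) ^ 2) := by
  have e : Real.cos (2 * (|x| * y)) = Real.cos (2 * y * x) := by
    rcases abs_choice x with h | h <;> rw [h]
    · ring_nf
    · rw [← Real.cos_neg]; ring_nf
  rw [e, mul_pow, sq_abs]
  rcases eq_or_ne x 0 with rfl | hx
  · simp
  rcases eq_or_ne y 0 with rfl | hy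
  · simp
  field_simp

theorem integrableOn_one_sub_cos_scaled (x : ℝ) :
    IntegrableOn (fun y : ℝ => (1 - Real.cos (2 * y * x)) / y ^ 2) (Ioi 0) := by
  simp only [one_sub_cos_scaled x]
  rcases eq_or_ne x 0 with rfl | hx
  · simp
  exact ((integrable_one_sub_cos_div_sq.comp_mul_left' (abs_ne_zero.2 hx)).const_mul _).integrableOn

theorem integral_one_sub_cos_scaled (x : ℝ) :
    ∫ y in Ioi (0:ℝ), (1 - Real.cos (2 * y * x)) / y ^ 2 = dirichletConst * |x| := by
  simp only [one_sub_cos_scaled x]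
  rcases eq_or_ne x 0 with rfl | hx
  · simp
  have hx' : 0 < |x| := abs_pos.2 hx
  rw [integral_const_mul, integral_comp_mul_left_Ioi
    (fun y => (1 - Real.cos (2 * y)) / y ^ 2) 0 hx', mul_zero, smul_eq_mul, dirichletConst]
  field_simp

theorem hypPair_eq_exp_dirichletConst {op om : ℂ} {G : ℂ → ℂ} (h : IsHypGamma op om G)
    (hop : 0 < op.re) (hom : 0 < om.re) {z : ℂ} (hz : |z.im| < ((op + om) / 2).re) (x : ℝ) :
    hypPair G z x = Complex.exp (2 * I * (∫ y in Ioi (0:ℝ),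
        (Real.cos (2 * y * x) : ℂ) * hypGammaKernel op om z y)
      - 2 * I * z / (op * om) * (dirichletConst * |x|)) := by
  have hopn : op ≠ 0 := fun h => by simp [h] at hop
  have homn : om ≠ 0 := fun h => by simp [h] at hom
  have hz1 : |((x:ℂ) + z).im| < ((op + om) / 2).re := by simpa using hz
  have hz2 : |(-(x:ℂ) + z).im| < ((op + om) / 2).re := by simpa using hz
  rw [hypPair, h.strip _ hz1, h.strip _ hz2, hypGammaInt_eq, hypGammaInt_eq, ← Complex.exp_add,
    ← mul_add, ← integral_add (hypGammaKernel_integrable hop hom hz1)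
      (hypGammaKernel_integrable hop hom hz2)]
  congr 1
  have hI1 : IntegrableOn (fun y : ℝ => (Real.cos (2 * y * x) : ℂ) * hypGammaKernel op om z y)
      (Ioi 0) := by
    refine (hypGammaKernel_integrable hop hom hz).bdd_mul (c := 1) ?_ ?_
    · exact (by fun_prop : Continuous fun y : ℝ => (Real.cos (2 * y * x) : ℂ)).aestronglyMeasurable
    · refine Eventually.of_forall fun y => ?_
      rw [Complex.norm_real]
      exact Real.abs_cos_le_one _
  have hI2 : IntegrableOn (fun y : ℝ => (((1 - Real.cos (2 * y * x)) / y ^ 2 : ℝ) : ℂ)) (Ioi 0) :=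
    (integrableOn_one_sub_cos_scaled x).ofReal
  have hI3 : ∫ y in Ioi (0:ℝ), (((1 - Real.cos (2 * y * x)) / y ^ 2 : ℝ) : ℂ)
      = dirichletConst * |x| := by
    rw [integral_complex_ofReal, integral_one_sub_cos_scaled, Complex.ofReal_mul]
  rw [show I * ∫ y in Ioi (0:ℝ), (hypGammaKernel op om ((x:ℂ) + z) y +
      hypGammaKernel op om (-(x:ℂ) + z) y) = I * (∫ y in Ioi (0:ℝ),
      (2 * ((Real.cos (2 * y * x) : ℂ) * hypGammaKernel op om z y)
        - 2 * z / (op * om) * (((1 - Real.cos (2 * y * x)) / y ^ 2 : ℝ) : ℂ))) from ?_,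
    integral_sub (hI1.const_mul 2) (hI2.const_mul _), integral_const_mul, integral_const_mul, hI3]
  · ring
  congr 1
  refine setIntegral_congr_fun measurableSet_Ioi fun y hy => ?_
  have h0 : (y : ℂ) ≠ 0 := by exact_mod_cast (ne_of_gt hy)
  have e1 : Complex.sin (2 * (y:ℂ) * (x + z)) + Complex.sin (2 * (y:ℂ) * (-x + z))
      = 2 * Complex.cos (2 * y * x) * Complex.sin (2 * y * z) := by
    rw [mul_add, mul_add, mul_neg, Complex.sin_add, Complex.sin_add, Complex.sin_neg,
      Complex.cos_neg]
    ring
  simp only [hypGammaKernel]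
  push_cast
  have e2 : ∀ S : ℂ, Complex.sin (2 * (y:ℂ) * (x + z)) * S + Complex.sin (2 * (y:ℂ) * (-x + z)) * S
      = 2 * Complex.cos (2 * y * x) * Complex.sin (2 * y * z) * S := fun S => by
    rw [← add_mul, e1]
  have e3 := e2 (2 * Complex.sinh (op * y) * Complex.sinh (om * y))⁻¹
  simp only [div_eq_mul_inv] at *
  have e4 : (y:ℂ) * (y:ℂ)⁻¹ = 1 := mul_inv_cancel₀ h0
  simp only [mul_inv]  at *
  linear_combination (y:ℂ)⁻¹ * e3

theorem tendsto_integral_cos_mul {f : ℝ → ℂ} (hf : IntegrableOn f (Ioi 0)) :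
    Tendsto (fun x : ℝ => ∫ y in Ioi (0:ℝ), (Real.cos (2 * y * x) : ℂ) * f y) atTop (𝓝 0) := by
  have hf' : Integrable (indicator (Ioi (0:ℝ)) f) := hf.integrable_indicator measurableSet_Ioi
  have hRL := Real.tendsto_integral_exp_smul_cocompact (indicator (Ioi (0:ℝ)) f)
  have hpi : 0 < Real.pi := Real.pi_pos
  have h1 : Tendsto (fun x : ℝ => x / Real.pi) atTop (cocompact ℝ) :=
    (tendsto_id.atTop_div_const hpi).mono_right atTop_le_cocompact
  have h2 : Tendsto (fun x : ℝ => -x / Real.pi) atTop (cocompact ℝ) := by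
    have : Tendsto (fun x : ℝ => -x / Real.pi) atTop atBot :=
      tendsto_neg_atTop_atBot.atBot_div_const hpi
    exact this.mono_right atBot_le_cocompact
  have hsum := ((hRL.comp h1).add (hRL.comp h2)).const_mul (1 / 2 : ℂ)
  simp only [add_zero, mul_zero] at hsum
  refine hsum.congr fun x => ?_
  simp only [Function.comp]
  have hfint : ∀ w : ℝ, Integrable (fun v : ℝ => Real.fourierChar (-(v * w)) •
      indicator (Ioi (0:ℝ)) f v) := fun w => by
    have := (VectorFourier.fourierIntegral_convergent_iff (μ := volume) (f := indicator (Ioi (0:ℝ)) f)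
      Real.continuous_fourierChar (L := innerₗ ℝ) (by fun_prop) w).2 hf'
    simpa [mul_comm] using this
  rw [← integral_add (hfint _) (hfint _), ← integral_const_mul, ← integral_indicator measurableSet_Ioi]
  congr 1
  ext v
  by_cases hv : v ∈ Ioi (0:ℝ)
  · simp only [indicator_of_mem hv, Circle.smul_def, smul_eq_mul, Real.fourierChar_apply]
    rw [Complex.ofReal_cos, Complex.cos]
    have hpi' : (Real.pi : ℂ) ≠ 0 := by exact_mod_cast hpi.ne'
    have e1 : ((2 * Real.pi * (-(v * (x / Real.pi))) : ℝ) : ℂ) * I = -((2 * v * x : ℝ) : ℂ) * I := by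
      push_cast; field_simp
    have e2 : ((2 * Real.pi * (-(v * (-x / Real.pi))) : ℝ) : ℂ) * I = ((2 * v * x : ℝ) : ℂ) * I := by
      push_cast; field_simp
    rw [e1, e2]
    ring
  · simp [indicator_of_notMem hv]

theorem tendsto_hypPair_aux {op om : ℂ} {G : ℂ → ℂ} (h : IsHypGamma op om G)
    (hop : 0 < op.re) (hom : 0 < om.re) {z : ℂ} (hz : |z.im| < ((op + om) / 2).re) :
    Tendsto (fun x : ℝ => hypPair G z x *
      Complex.exp (2 * I * z / (op * om) * (dirichletConst * x))) atTop (𝓝 1) := by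
  have h1 := (tendsto_integral_cos_mul (hypGammaKernel_integrable hop hom hz)).const_mul (2 * I)
  have h2 := (Complex.continuous_exp.tendsto _).comp h1
  rw [mul_zero, Complex.exp_zero] at h2
  refine h2.congr' ?_
  filter_upwards [eventually_ge_atTop (0:ℝ)] with x hx
  rw [hypPair_eq_exp_dirichletConst h hop hom hz, ← Complex.exp_add, abs_of_nonneg hx]
  simp

theorem dirichletConst_eq_pi {G : ℂ → ℂ} (h : IsHypGamma 1 1 G) : dirichletConst = Real.pi := by
  have hz : |(I / 2 : ℂ).im| < (((1:ℂ) + 1) / 2).re := by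
    norm_num
  have h1 := tendsto_hypPair_aux h (by simp) (by simp) hz
  have hp : ∀ x : ℝ, hypPair G (I / 2) x = ((2 * Real.cosh (Real.pi * x) : ℝ) : ℂ) := by
    intro x
    have e1 := h.add_om (by simp) (by simp) (z := (x:ℂ) - I / 2) (by norm_num)
    have e2 := h.reflection_of_strip (z := (x:ℂ) - I / 2) (by norm_num)
    rw [hypPair, show (x:ℂ) + I / 2 = x - I / 2 + I * 1 by ring, e1,
      show -(x:ℂ) + I / 2 = -(x - I / 2) by ring, mul_assoc, e2]
    push_cast
    simp
  simp only [hp] at h1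
  have h2 : Tendsto (fun x : ℝ => 2 * Real.cosh (Real.pi * x) * Real.exp (-dirichletConst * x))
      atTop (𝓝 1) := by
    have h3 := (Complex.continuous_re.tendsto _).comp h1
    rw [Complex.one_re] at h3
    refine h3.congr fun x => ?_
    simp only [Function.comp]
    have : 2 * I * (I / 2) / (1 * 1) * (dirichletConst * (x:ℂ)) = ((-dirichletConst * x : ℝ) : ℂ) := by
      push_cast
      linear_combination (dirichletConst * (x:ℂ)) * Complex.I_mul_I
    rw [this, ← Complex.ofReal_exp, ← Complex.ofReal_mul, Complex.ofReal_re]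
  have h4 : Tendsto (fun x : ℝ => 1 + Real.exp (-(2 * Real.pi) * x)) atTop (𝓝 1) := by
    have : Tendsto (fun x : ℝ => -(2 * Real.pi) * x) atTop atBot :=
      tendsto_id.const_mul_atTop_of_neg (by linarith [Real.pi_pos])
    simpa using (Real.tendsto_exp_atBot.comp this).const_add 1
  have h5 := h2.div h4 one_ne_zero
  have h6 : Tendsto (fun x : ℝ => Real.exp ((Real.pi - dirichletConst) * x)) atTop (𝓝 1) := by
    rw [div_one] at h5
    refine h5.congr fun x => ?_
    simp only [Pi.div_apply]
    rw [div_eq_iff (by positivity), Real.cosh_eq, mul_add, mul_one, ← Real.exp_add]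
    rw [show 2 * ((Real.exp (Real.pi * x) + Real.exp (-(Real.pi * x))) / 2) *
      Real.exp (-dirichletConst * x) = Real.exp (Real.pi * x) * Real.exp (-dirichletConst * x)
        + Real.exp (-(Real.pi * x)) * Real.exp (-dirichletConst * x) by ring, ← Real.exp_add,
      ← Real.exp_add]
    ring_nf
  have h7 := (Real.continuousAt_log one_ne_zero).tendsto.comp h6
  simp only [Function.comp_def, Real.log_exp, Real.log_one] at h7
  by_contra hne
  rcases lt_or_gt_of_ne hne with hlt | hgt
  · exact not_tendsto_nhds_of_tendsto_atTop
      (tendsto_id.const_mul_atTop (sub_pos.2 hlt)) 0 h7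
  · exact not_tendsto_nhds_of_tendsto_atBot
      (tendsto_id.const_mul_atTop_of_neg (sub_neg.2 hgt)) 0 h7

theorem hypPair_add_om {op om : ℂ} {G : ℂ → ℂ} (h : IsHypGamma op om G)
    (hop : 0 < op.re) (hom : 0 < om.re) {z : ℂ} (hz : -((op + om) / 2).re < z.im) (x : ℝ) :
    hypPair G (z + I * om) x =
      (2 * Complex.cosh (Real.pi * x / op + Real.pi * (z + I * om / 2) / op)) *
      (2 * Complex.cosh (-(Real.pi * x / op) + Real.pi * (z + I * om / 2) / op)) *
      hypPair G z x := by
  have e1 := h.add_om hop hom (z := (x:ℂ) + z) (by simpa using hz)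
  have e2 := h.add_om hop hom (z := -(x:ℂ) + z) (by simpa using hz)
  simp only [hypPair, ← add_assoc]
  rw [e1, e2]
  ring_nf

theorem tendsto_cosh_mul_cosh {a : ℂ} (ha : 0 < a.re) (c : ℂ) :
    Tendsto (fun x : ℝ => (2 * Complex.cosh (a * x + c)) * (2 * Complex.cosh (-(a * x) + c)) *
      Complex.exp (-2 * (a * x))) atTop (𝓝 1) := by
  have h0 : Tendsto (fun x : ℝ => Complex.exp (-2 * (a * x))) atTop (𝓝 0) := by
    rw [tendsto_zero_iff_norm_tendsto_zero]
    have : Tendsto (fun x : ℝ => (-2 * a.re) * x) atTop atBot :=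
      tendsto_id.const_mul_atTop_of_neg (by linarith)
    refine (Real.tendsto_exp_atBot.comp this).congr fun x => ?_
    simp [Complex.norm_exp, mul_assoc]
  have h1 : Tendsto (fun x : ℝ => (1 + Complex.exp (-2 * (a * x)) * Complex.exp (-2 * c)) *
      (1 + Complex.exp (-2 * (a * x)) * Complex.exp (2 * c))) atTop (𝓝 1) := by
    have := ((h0.mul_const (Complex.exp (-2 * c))).const_add 1).mul
      ((h0.mul_const (Complex.exp (2 * c))).const_add 1)
    simpa using this
  refine h1.congr fun x => ?_
  rw [Complex.cosh, Complex.cosh]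
  set u := a * (x:ℂ)
  rw [show -2 * u = -u + -u by ring, show -2 * c = -c + -c by ring, show 2 * c = c + c by ring,
    show -(u + c) = -u + -c by ring, show -(-u + c) = u + -c by ring]
  simp only [Complex.exp_add]
  have e1 : Complex.exp u * Complex.exp (-u) = 1 := by
    rw [← Complex.exp_add, add_neg_cancel, Complex.exp_zero]
  have e2 : Complex.exp c * Complex.exp (-c) = 1 := by
    rw [← Complex.exp_add, add_neg_cancel, Complex.exp_zero]
  generalize Complex.exp u = A at *
  generalize Complex.exp (-u) = B at *
  generalize Complex.exp c = C at *
  generalize Complex.exp (-c) = D at *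
  have hA : B ≠ 0 := right_ne_zero_of_mul_eq_one e1
  have hC : D ≠ 0 := right_ne_zero_of_mul_eq_one e2
  obtain rfl : A = B⁻¹ := eq_inv_of_mul_eq_one_left e1
  obtain rfl : C = D⁻¹ := eq_inv_of_mul_eq_one_left e2
  field_simp
  ring

theorem re_inv_pos {a : ℂ} (ha : 0 < a.re) : 0 < (1 / a).re := by
  have hn : a ≠ 0 := fun h => by simp [h] at ha
  rw [one_div, Complex.inv_re]
  exact div_pos ha (Complex.normSq_pos.2 hn)

/-- Asymptotics of the pair product on the positive real axis. -/
theorem tendsto_hypPair {op om : ℂ} {G G₁ : ℂ → ℂ} (h : IsHypGamma op om G)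
    (h₁ : IsHypGamma 1 1 G₁) (hop : 0 < op.re) (hom : 0 < om.re) {z : ℂ}
    (hz : -((op + om) / 2).re < z.im) :
    Tendsto (fun x : ℝ => hypPair G z x *
      Complex.exp (2 * Real.pi * I * z / (op * om) * x)) atTop (𝓝 1) := by
  have hopn : op ≠ 0 := fun h => by simp [h] at hop
  have homn : om ≠ 0 := fun h => by simp [h] at hom
  refine halfPlane_induction hop hom (P := fun z => Tendsto (fun x : ℝ => hypPair G z x *
      Complex.exp (2 * Real.pi * I * z / (op * om) * x)) atTop (𝓝 1)) (fun z hz => ?_)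
    (fun z hz1 _ ih => ?_) hz
  · refine (tendsto_hypPair_aux h hop hom hz).congr fun x => ?_
    rw [dirichletConst_eq_pi h₁]
    ring_nf
  · have hre : 0 < (Real.pi / op).re := by
      rw [div_eq_mul_one_div, Complex.re_ofReal_mul]
      exact mul_pos Real.pi_pos (re_inv_pos hop)
    have := (tendsto_cosh_mul_cosh hre (Real.pi * (z + I * om / 2) / op)).mul ih
    rw [mul_one] at this
    refine this.congr fun x => ?_
    rw [hypPair_add_om h hop hom hz1, show 2 * Real.pi * I * (z + I * om) / (op * om) * (x:ℂ)
      = -2 * (Real.pi / op * x) + 2 * Real.pi * I * z / (op * om) * x from ?_, Complex.exp_add,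
      show (Real.pi / op * x : ℂ) = Real.pi * x / op by ring]
    · ring
    · field_simp
      linear_combination ((x:ℂ) * om) * Complex.I_mul_I

theorem dirichlet_exponent_re (u : ℂ) (x : ℝ) :
    (-(2 * I * u * (Real.pi * |x|))).re = -(2 * Real.pi * (I * u).re * |x|) := by
  have : -(2 * I * u * (Real.pi * |x|)) = ((-(2 * Real.pi * |x|) : ℝ) : ℂ) * (I * u) := by
    push_cast; ring
  rw [this, Complex.re_ofReal_mul]
  ring

/-- Exponential bound for the pair product on the real line, locally uniform in one quasi-period
and in the shift. -/
theorem hypPair_bound {G : ℂ → ℂ → ℂ → ℂ}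
    (hG : ∀ a b : ℂ, 0 < a.re → 0 < b.re → IsHypGamma a b (G a b)) {op om : ℂ}
    (hop : 0 < op.re) (hom : 0 < om.re) {z : ℂ} (hz : -((op + om) / 2).re < z.im) :
    ∃ C : ℝ, 0 ≤ C ∧ ∀ᶠ q : ℂ × ℂ in 𝓝 (op, z), ∀ x : ℝ, ‖hypPair (G q.1 om) q.2 x‖ ≤
      C * Real.exp (-(2 * Real.pi * (I * (q.2 / (q.1 * om))).re * |x|)) := by
  have hopn : op ≠ 0 := fun h => by simp [h] at hop
  have homn : om ≠ 0 := fun h => by simp [h] at hom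
  have hre : ∀ z, ∀ᶠ q : ℂ × ℂ in 𝓝 (op, z), 0 < q.1.re := fun z =>
    (Continuous.continuousAt (by fun_prop : Continuous fun q : ℂ × ℂ => q.1.re)).eventually
      (lt_mem_nhds hop)
  refine halfPlane_induction hop hom (P := fun z => ∃ C : ℝ, 0 ≤ C ∧ ∀ᶠ q : ℂ × ℂ in 𝓝 (op, z),
    ∀ x : ℝ, ‖hypPair (G q.1 om) q.2 x‖ ≤
      C * Real.exp (-(2 * Real.pi * (I * (q.2 / (q.1 * om))).re * |x|))) (fun z hz => ?_)
    (fun z hz1 _ ih => ?_) hz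
  · obtain ⟨b, hb, hev⟩ := hypGammaKernel_dominated hop hom hz
    refine ⟨Real.exp (2 * ∫ y in Ioi (0:ℝ), b y), (Real.exp_pos _).le, ?_⟩
    have hst : ∀ᶠ q : ℂ × ℂ in 𝓝 (op, z), |q.2.im| < ((q.1 + om) / 2).re := by
      have h1 : IsOpen {q : ℂ × ℂ | |q.2.im| < ((q.1 + om) / 2).re} := by
        refine isOpen_lt (by fun_prop) ?_
        exact Complex.continuous_re.comp (by fun_prop)
      exact h1.mem_nhds hz
    filter_upwards [hre z, hst, hev] with q hq1 hq2 hq3 x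
    rw [hypPair_eq_exp_dirichletConst (hG _ _ hq1 hom) hq1 hom hq2,
      dirichletConst_eq_pi (hG 1 1 (by simp) (by simp)), Complex.norm_exp, ← Real.exp_add,
      sub_eq_add_neg, Complex.add_re, show 2 * I * q.2 / (q.1 * om) * (Real.pi * |x|)
        = 2 * I * (q.2 / (q.1 * om)) * (Real.pi * |x|) by ring, dirichlet_exponent_re]
    refine Real.exp_le_exp.2 (add_le_add_left ?_ _)
    refine (Complex.re_le_norm _).trans ?_
    rw [norm_mul, norm_mul, Complex.norm_I, Complex.norm_ofNat, mul_one]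
    refine mul_le_mul_of_nonneg_left ?_ zero_le_two
    refine norm_integral_le_of_norm_le hb ?_
    refine (ae_restrict_iff' measurableSet_Ioi).2 (Eventually.of_forall fun y hy => ?_)
    rw [norm_mul, Complex.norm_real]
    exact (mul_le_of_le_one_left (norm_nonneg _) (Real.abs_cos_le_one _)).trans (hq3 y hy)
  · obtain ⟨C, hC, hev⟩ := ih
    have hmap : Tendsto (fun q : ℂ × ℂ => (q.1, q.2 - I * om)) (𝓝 (op, z + I * om))
        (𝓝 (op, z)) := by
      have : Continuous fun q : ℂ × ℂ => (q.1, q.2 - I * om) := by fun_prop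
      simpa using this.tendsto (op, z + I * om)
    have hc : ContinuousAt (fun q : ℂ × ℂ => |(Real.pi * (q.2 - I * om + I * om / 2) / q.1).re|)
        (op, z + I * om) := by
      refine (Complex.continuous_re.continuousAt.comp ?_).abs
      exact ContinuousAt.div (by fun_prop) (by fun_prop) hopn
    obtain ⟨D, hD⟩ := exists_gt |(Real.pi * (z + I * om - I * om + I * om / 2) / op).re|
    have hc' := hc.eventually (gt_mem_nhds hD)
    refine ⟨4 * (Real.exp D * Real.exp D) * C, by positivity, ?_⟩
    have hst : ∀ᶠ q : ℂ × ℂ in 𝓝 (op, z + I * om),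
        -((q.1 + om) / 2).re < (q.2 - I * om).im := by
      have h1 : IsOpen {q : ℂ × ℂ | -((q.1 + om) / 2).re < (q.2 - I * om).im} := by
        refine isOpen_lt ?_ (Complex.continuous_im.comp (by fun_prop))
        exact (Complex.continuous_re.comp (by fun_prop)).neg
      exact h1.mem_nhds (by simpa only [Set.mem_ofPred_eq, add_sub_cancel_right] using hz1)
    filter_upwards [hre _, hst, hc', hmap.eventually hev] with q hq1 hq2 hq3 hq4 x
    have hqn : q.1 ≠ 0 := fun h => by simp [h] at hq1
    have hbd := hq4 x
    have e := hypPair_add_om (hG _ _ hq1 hom) hq1 hom hq2 x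
    rw [sub_add_cancel] at e
    set c := Real.pi * (q.2 - I * om + I * om / 2) / q.1 with hc_def
    have hr : (Real.pi * x / q.1 : ℂ).re = Real.pi * x * (1 / q.1).re := by
      rw [show (Real.pi * x / q.1 : ℂ) = ((Real.pi * x : ℝ) : ℂ) * (1 / q.1) by push_cast; ring,
        Complex.re_ofReal_mul]
    have hpos := re_inv_pos hq1
    have hra : |(Real.pi * x / q.1 : ℂ).re| = Real.pi * |x| * (1 / q.1).re := by
      rw [hr, abs_mul, abs_mul, abs_of_pos hpos, abs_of_pos Real.pi_pos]
    have b1 : ‖Complex.cosh (Real.pi * x / q.1 + c)‖ ≤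
        Real.exp (Real.pi * |x| * (1 / q.1).re + D) := by
      refine (norm_cosh_le_exp _).trans (Real.exp_le_exp.2 ?_)
      rw [Complex.add_re]
      exact (abs_add_le _ _).trans (add_le_add hra.le hq3.le)
    have b2 : ‖Complex.cosh (-(Real.pi * x / q.1) + c)‖ ≤
        Real.exp (Real.pi * |x| * (1 / q.1).re + D) := by
      refine (norm_cosh_le_exp _).trans (Real.exp_le_exp.2 ?_)
      rw [Complex.add_re, Complex.neg_re]
      refine (abs_add_le _ _).trans (add_le_add ?_ hq3.le)
      rw [abs_neg, hra]
    have hexp : (I * (q.2 / (q.1 * om))).re = (I * ((q.2 - I * om) / (q.1 * om))).re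
        - (1 / q.1).re := by
      rw [← Complex.sub_re]
      congr 1
      field_simp
      linear_combination om * Complex.I_mul_I
    rw [e, norm_mul, norm_mul, norm_mul, norm_mul, Complex.norm_ofNat]
    calc 2 * ‖Complex.cosh (Real.pi * x / q.1 + c)‖ *
          (2 * ‖Complex.cosh (-(Real.pi * x / q.1) + c)‖) * ‖hypPair (G q.1 om) (q.2 - I * om) x‖
        ≤ 2 * Real.exp (Real.pi * |x| * (1 / q.1).re + D) *
          (2 * Real.exp (Real.pi * |x| * (1 / q.1).re + D)) *
          (C * Real.exp (-(2 * Real.pi * (I * ((q.2 - I * om) / (q.1 * om))).re * |x|))) := by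
          gcongr
      _ = 4 * (Real.exp D * Real.exp D) * C *
          Real.exp (-(2 * Real.pi * (I * (q.2 / (q.1 * om))).re * |x|)) := by
          rw [hexp, Real.exp_add, show -(2 * Real.pi * ((I * ((q.2 - I * om) / (q.1 * om))).re
            - (1 / q.1).re) * |x|) = -(2 * Real.pi * (I * ((q.2 - I * om) / (q.1 * om))).re * |x|)
            + (Real.pi * |x| * (1 / q.1).re + Real.pi * |x| * (1 / q.1).re) by ring,
            Real.exp_add, Real.exp_add]
          generalize Real.exp (Real.pi * |x| * (1 / q.1).re) = E
          ring

theorem IsHypGamma.hypPair_differentiableAt {op om : ℂ} {G : ℂ → ℂ} (h : IsHypGamma op om G)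
    (hop : 0 < op.re) (hom : 0 < om.re) {z x : ℂ}
    (hz1 : -((op + om) / 2).re < (x + z).im) (hz2 : -((op + om) / 2).re < (-x + z).im) :
    DifferentiableAt ℂ (hypPair G z) x := by
  have h1 : DifferentiableAt ℂ (fun w => G (w + z)) x :=
    (h.differentiableAt hop hom hz1).comp (f := fun w => w + z) x (by fun_prop)
  have h2 : DifferentiableAt ℂ (fun w => G (-w + z)) x :=
    (h.differentiableAt hop hom hz2).comp (f := fun w => -w + z) x (by fun_prop)
  exact h1.mul h2

theorem IsHypGamma.continuous_hypPair {op om : ℂ} {G : ℂ → ℂ} (h : IsHypGamma op om G)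
    (hop : 0 < op.re) (hom : 0 < om.re) {z : ℂ} (hz : -((op + om) / 2).re < z.im) :
    Continuous fun x : ℝ => hypPair G z x := by
  refine continuous_iff_continuousAt.2 fun x => ?_
  exact ContinuousAt.comp (g := hypPair G z)
    (h.hypPair_differentiableAt hop hom (by simpa using hz) (by simpa using hz)).continuousAt
    Complex.continuous_ofReal.continuousAt

theorem hypPair_bound_single {G : ℂ → ℂ → ℂ → ℂ}
    (hG : ∀ a b : ℂ, 0 < a.re → 0 < b.re → IsHypGamma a b (G a b)) {op om : ℂ}
    (hop : 0 < op.re) (hom : 0 < om.re) {z : ℂ} (hz : -((op + om) / 2).re < z.im) :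
    ∃ C : ℝ, 0 ≤ C ∧ ∀ x : ℝ, ‖hypPair (G op om) z x‖ ≤
      C * Real.exp (-(2 * Real.pi * (I * (z / (op * om))).re * |x|)) := by
  obtain ⟨C, hC, h⟩ := hypPair_bound hG hop hom hz
  exact ⟨C, hC, h.self_of_nhds⟩

/-! ### Shifting the contour across a horizontal strip -/

theorem norm_exp_neg_pow_four {ε : ℝ} (z : ℂ) :
    ‖Complex.exp (-(ε * z ^ 4))‖
      = Real.exp (-(ε * (z.re ^ 4 - 6 * z.re ^ 2 * z.im ^ 2 + z.im ^ 4))) := by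
  rw [Complex.norm_exp, Complex.neg_re, Complex.re_ofReal_mul]
  have : (z ^ 4).re = z.re ^ 4 - 6 * z.re ^ 2 * z.im ^ 2 + z.im ^ 4 := by
    simp only [pow_succ, pow_zero, one_mul, Complex.mul_re, Complex.mul_im]
    ring
  rw [this]

theorem tendsto_cubic_sub_quartic {C ε m : ℝ} (hC : 0 ≤ C) (hε : 0 < ε) (hm : 0 ≤ m) :
    Tendsto (fun T : ℝ => C * (1 + T + m) ^ 3 - ε * (T ^ 4 - 6 * T ^ 2 * m ^ 2)) atTop atBot := by
  set K := C * (2 + m) ^ 3 + 6 * ε * m ^ 2 with hK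
  have hK0 : 0 ≤ K := by positivity
  refine tendsto_atBot_mono' _ ?_ tendsto_neg_atTop_atBot
  filter_upwards [eventually_ge_atTop (1:ℝ), eventually_ge_atTop ((K + 1) / ε)] with T h1 h2
  rw [div_le_iff₀ hε] at h2
  have h3 : (1 + T + m) ^ 3 ≤ (2 + m) ^ 3 * T ^ 3 := by
    rw [← mul_pow]
    gcongr
    nlinarith
  have h4 : T ^ 2 ≤ T ^ 3 := pow_le_pow_right₀ h1 (by norm_num)
  have h5 : T ≤ T ^ 3 := by simpa using pow_le_pow_right₀ h1 (show 1 ≤ 3 by norm_num)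
  have h6 : C * (1 + T + m) ^ 3 ≤ C * ((2 + m) ^ 3 * T ^ 3) := by gcongr
  have h7 : 6 * ε * m ^ 2 * T ^ 2 ≤ 6 * ε * m ^ 2 * T ^ 3 := by gcongr
  have h8 : (K + 1) * T ^ 3 ≤ T * ε * T ^ 3 := by gcongr
  rw [hK] at h8
  nlinarith

theorem integral_eq_of_strip_aux {f : ℂ → ℂ} {a b ε C m : ℝ} (hab : a ≤ b) (hε : 0 < ε)
    (hC : 0 ≤ C) (hma : |a| ≤ m) (hmb : |b| ≤ m)
    (hd : ∀ z : ℂ, a ≤ z.im → z.im ≤ b → DifferentiableAt ℂ f z)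
    (hg : ∀ z : ℂ, a ≤ z.im → z.im ≤ b → ‖f z‖ ≤ Real.exp (C * (1 + ‖z‖) ^ 3))
    (ha : Integrable fun x : ℝ => f (x + a * I) * Complex.exp (-(ε * (x + a * I) ^ 4)))
    (hb : Integrable fun x : ℝ => f (x + b * I) * Complex.exp (-(ε * (x + b * I) ^ 4))) :
    ∫ x : ℝ, f (x + a * I) * Complex.exp (-(ε * (x + a * I) ^ 4))
      = ∫ x : ℝ, f (x + b * I) * Complex.exp (-(ε * (x + b * I) ^ 4)) := by
  have hm : 0 ≤ m := (abs_nonneg a).trans hma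
  set F : ℂ → ℂ := fun z => f z * Complex.exp (-(ε * z ^ 4)) with hF
  have hFd : ∀ z : ℂ, a ≤ z.im → z.im ≤ b → DifferentiableAt ℂ F z := fun z h1 h2 =>
    (hd z h1 h2).mul (by fun_prop)
  have hside : ∀ s : ℝ → ℝ, (∀ T, |s T| = |T|) →
      Tendsto (fun T : ℝ => ∫ y in a..b, F (s T + y * I)) atTop (𝓝 0) := by
    intro s hs
    have hexp := (Real.tendsto_exp_atBot.comp
      (tendsto_cubic_sub_quartic hC hε hm)).mul_const |b - a|
    rw [zero_mul] at hexp
    refine squeeze_zero_norm' ?_ hexp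
    filter_upwards [eventually_ge_atTop (0:ℝ)] with T hT
    refine intervalIntegral.norm_integral_le_of_norm_le_const fun y hy => ?_
    rw [uIoc_of_le hab] at hy
    have him : ((s T : ℂ) + y * I).im = y := by simp
    have hre : ((s T : ℂ) + y * I).re = s T := by simp
    have hym : |y| ≤ m := abs_le.2 ⟨by linarith [(abs_le.1 hma).1, hy.1],
      by linarith [(abs_le.1 hmb).2, hy.2]⟩
    have hym2 : y ^ 2 ≤ m ^ 2 := sq_le_sq' (by linarith [(abs_le.1 hym).1]) (abs_le.1 hym).2
    have hsT2 : s T ^ 2 = T ^ 2 := (sq_eq_sq_iff_abs_eq_abs _ _).2 (hs T)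
    have hsT4 : s T ^ 4 = T ^ 4 := by
      rw [show s T ^ 4 = (s T ^ 2) ^ 2 by ring, hsT2]; ring
    have hn : ‖(s T : ℂ) + y * I‖ ≤ T + m := by
      refine (norm_add_le _ _).trans ?_
      rw [norm_mul, Complex.norm_I, mul_one, Complex.norm_real, Complex.norm_real,
        Real.norm_eq_abs, Real.norm_eq_abs, hs, abs_of_nonneg hT]
      linarith
    rw [hF, norm_mul, norm_exp_neg_pow_four, him, hre]
    calc _ ≤ Real.exp (C * (1 + ‖(s T : ℂ) + y * I‖) ^ 3) *
          Real.exp (-(ε * (s T ^ 4 - 6 * s T ^ 2 * y ^ 2 + y ^ 4))) := by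
          gcongr
          exact hg _ (by rw [him]; exact hy.1.le) (by rw [him]; exact hy.2)
      _ ≤ _ := by
          rw [← Real.exp_add]
          refine Real.exp_le_exp.2 ?_
          rw [hsT2, hsT4]
          show _ ≤ C * (1 + T + m) ^ 3 - ε * (T ^ 4 - 6 * T ^ 2 * m ^ 2)
          rw [sub_eq_add_neg (C * _)]
          refine add_le_add ?_ (neg_le_neg ?_)
          · rw [add_assoc]
            gcongr
          · refine mul_le_mul_of_nonneg_left ?_ hε.le
            nlinarith [mul_le_mul_of_nonneg_left hym2 (sq_nonneg T), sq_nonneg (y ^ 2)]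
  have hlim := (((intervalIntegral_tendsto_integral ha tendsto_neg_atTop_atBot tendsto_id).sub
    (intervalIntegral_tendsto_integral hb tendsto_neg_atTop_atBot tendsto_id)).add
    ((hside id fun T => rfl).const_smul I)).sub ((hside (fun T => -T) fun T => abs_neg T).const_smul I)
  have hzero : ∀ T : ℝ, ((∫ x in (-T)..T, F (x + a * I)) - (∫ x in (-T)..T, F (x + b * I))
      + I • ∫ y in a..b, F (T + y * I)) - I • (∫ y in a..b, F ((-T : ℝ) + y * I)) = 0 := by
    intro T
    have := Complex.integral_boundary_rect_eq_zero_of_differentiableOn F (⟨-T, a⟩ : ℂ) ⟨T, b⟩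
      (fun z hz => by
        obtain ⟨_, h2⟩ := hz
        rw [mem_preimage, uIcc_of_le (by exact hab)] at h2
        exact (hFd z h2.1 h2.2).differentiableWithinAt)
    simpa using this
  have := tendsto_nhds_unique (hlim.congr fun T => hzero T) tendsto_const_nhds
  simpa [sub_eq_zero] using this

theorem norm_mul_exp_neg_pow_four_le {ε m : ℝ} (hε : 0 ≤ ε) (hε1 : ε ≤ 1) {z : ℂ}
    (hz : |z.im| ≤ m) : ‖Complex.exp (-(ε * z ^ 4))‖ ≤ Real.exp (8 * m ^ 4) := by
  rw [norm_exp_neg_pow_four]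
  refine Real.exp_le_exp.2 ?_
  have h2 : z.im ^ 4 ≤ m ^ 4 := by
    rw [← Even.pow_abs (by decide : Even 4)]
    exact pow_le_pow_left₀ (abs_nonneg _) hz 4
  have h3 : -(z.re ^ 4 - 6 * z.re ^ 2 * z.im ^ 2 + z.im ^ 4) ≤ 8 * m ^ 4 := by
    nlinarith [sq_nonneg (z.re ^ 2 - 3 * z.im ^ 2)]
  have h4 : 0 ≤ 8 * m ^ 4 := by positivity
  nlinarith

theorem tendsto_integral_damped {f : ℂ → ℂ} {a : ℝ}
    (ha : Integrable fun x : ℝ => f (x + a * I)) :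
    (∀ ε : ℝ, 0 ≤ ε → ε ≤ 1 →
      Integrable fun x : ℝ => f (x + a * I) * Complex.exp (-(ε * (x + a * I) ^ 4))) ∧
    Tendsto (fun n : ℕ => ∫ x : ℝ, f (x + a * I) *
      Complex.exp (-(((1 / ((n:ℝ) + 1) : ℝ) : ℂ) * (x + a * I) ^ 4))) atTop
      (𝓝 (∫ x : ℝ, f (x + a * I))) := by
  have hmeas : ∀ ε : ℝ, AEStronglyMeasurable
      (fun x : ℝ => f (x + a * I) * Complex.exp (-(ε * (x + a * I) ^ 4))) volume := fun ε =>
    ha.aestronglyMeasurable.mul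
      (by fun_prop : Continuous fun x : ℝ => Complex.exp (-(ε * (x + a * I) ^ 4))).aestronglyMeasurable
  have hbd : ∀ ε : ℝ, 0 ≤ ε → ε ≤ 1 → ∀ x : ℝ,
      ‖f (x + a * I) * Complex.exp (-(ε * (x + a * I) ^ 4))‖
        ≤ ‖f (x + a * I)‖ * Real.exp (8 * |a| ^ 4) := by
    intro ε h0 h1 x
    rw [norm_mul]
    exact mul_le_mul_of_nonneg_left (norm_mul_exp_neg_pow_four_le h0 h1 (by simp)) (norm_nonneg _)
  refine ⟨fun ε h0 h1 => (ha.norm.mul_const _).mono' (hmeas ε) (Eventually.of_forall (hbd ε h0 h1)), ?_⟩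
  have hn0 : ∀ n : ℕ, (0:ℝ) ≤ 1 / ((n:ℝ) + 1) := fun n => by positivity
  have hn1 : ∀ n : ℕ, 1 / ((n:ℝ) + 1) ≤ 1 := fun n => by
    rw [div_le_one (by positivity)]
    linarith [(n.cast_nonneg : (0:ℝ) ≤ n)]
  refine tendsto_integral_of_dominated_convergence _ (fun n => hmeas _) (ha.norm.mul_const _)
    (fun n => Eventually.of_forall (hbd _ (hn0 n) (hn1 n))) (Eventually.of_forall fun x => ?_)
  have h1 : Tendsto (fun n : ℕ => ((1 / ((n:ℝ) + 1) : ℝ) : ℂ)) atTop (𝓝 ((0:ℝ) : ℂ)) :=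
    (Complex.continuous_ofReal.tendsto 0).comp tendsto_one_div_add_atTop_nhds_zero_nat
  have h2 : Continuous fun ε : ℂ => f (x + a * I) * Complex.exp (-(ε * (x + a * I) ^ 4)) := by
    fun_prop
  simpa [Function.comp_def] using (h2.tendsto _).comp h1

theorem integral_eq_of_strip {f : ℂ → ℂ} {c₁ c₂ : ℂ} (hc : c₁.im ≤ c₂.im)
    (hd : ∀ z : ℂ, c₁.im ≤ z.im → z.im ≤ c₂.im → DifferentiableAt ℂ f z)
    (hg : ∃ C : ℝ, 0 ≤ C ∧ ∀ z : ℂ, c₁.im ≤ z.im → z.im ≤ c₂.im →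
      ‖f z‖ ≤ Real.exp (C * (1 + ‖z‖) ^ 3))
    (h₁ : Integrable fun x : ℝ => f (x + c₁)) (h₂ : Integrable fun x : ℝ => f (x + c₂)) :
    ∫ x : ℝ, f (x + c₁) = ∫ x : ℝ, f (x + c₂) := by
  have hshift : ∀ c : ℂ, (fun x : ℝ => f (x + c)) = fun x : ℝ => f ((x + c.re : ℝ) + c.im * I) := by
    intro c
    ext x
    congr 1
    conv_lhs => rw [← Complex.re_add_im c]
    push_cast
    ring
  have hfint : ∀ c : ℂ, Integrable (fun x : ℝ => f (x + c)) →
      Integrable fun x : ℝ => f (x + c.im * I) := by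
    intro c h
    rw [hshift] at h
    simpa using h.comp_sub_right c.re
  have heq : ∀ c : ℂ, ∫ x : ℝ, f (x + c) = ∫ x : ℝ, f (x + c.im * I) := by
    intro c
    rw [hshift]
    exact integral_add_right_eq_self (fun x : ℝ => f ((x : ℝ) + c.im * I)) c.re
  rw [heq c₁, heq c₂]
  obtain ⟨i1, t1⟩ := tendsto_integral_damped (hfint _ h₁)
  obtain ⟨i2, t2⟩ := tendsto_integral_damped (hfint _ h₂)
  obtain ⟨C, hC, hg⟩ := hg
  refine tendsto_nhds_unique t1 (t2.congr fun n => ?_)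
  have hn0 : (0:ℝ) < 1 / ((n:ℝ) + 1) := by positivity
  have hn1 : 1 / ((n:ℝ) + 1) ≤ 1 := by
    rw [div_le_one (by positivity)]
    linarith [(n.cast_nonneg : (0:ℝ) ≤ n)]
  exact (integral_eq_of_strip_aux hc hn0 hC (le_max_left |c₁.im| |c₂.im|) (le_max_right _ _) hd hg
    (i1 _ hn0.le hn1) (i2 _ hn0.le hn1)).symm

/-! ### The Fourier transform of the pair product -/

theorem integrable_exp_neg_mul_abs {c : ℝ} (hc : 0 < c) :
    Integrable fun x : ℝ => Real.exp (-(c * |x|)) := by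
  rw [← integrableOn_univ, ← Iic_union_Ioi (a := (0:ℝ))]
  refine IntegrableOn.union ?_ ?_
  · refine (integrableOn_exp_mul_Iic hc 0).congr_fun (fun x hx => ?_) measurableSet_Iic
    rw [abs_of_nonpos hx]
    ring_nf
  · refine (integrableOn_exp_mul_Ioi (a := -c) (by linarith) 0).congr_fun (fun x hx => ?_)
      measurableSet_Ioi
    simp only [abs_of_pos (show 0 < x from hx)]
    ring_nf

/-- The exponentials `e^{2πitx}` with complex frequency `t`. -/
def planeWave (t : ℂ) (x : ℂ) : ℂ := Complex.exp (2 * Real.pi * I * t * x)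

theorem norm_planeWave (t : ℂ) (x : ℝ) :
    ‖planeWave t x‖ = Real.exp (-(2 * Real.pi * t.im * x)) := by
  rw [planeWave, Complex.norm_exp]
  congr 1
  rw [show 2 * (Real.pi:ℂ) * I * t * x = ((2 * Real.pi * x : ℝ) : ℂ) * (I * t) by push_cast; ring,
    Complex.re_ofReal_mul]
  simp
  ring

theorem norm_planeWave_le (t : ℂ) (x : ℝ) :
    ‖planeWave t x‖ ≤ Real.exp (2 * Real.pi * |t.im| * |x|) := by
  rw [norm_planeWave]
  refine Real.exp_le_exp.2 ?_
  have := neg_le_abs (t.im * x)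
  rw [abs_mul] at this
  nlinarith [Real.pi_pos]

/-- A continuous function on the line decaying at least like `e^{-2πρ|x|}`. -/
structure ExpDecay (f : ℝ → ℂ) (ρ : ℝ) : Prop where
  continuous : Continuous f
  bound : ∃ C : ℝ, 0 ≤ C ∧ ∀ x : ℝ, ‖f x‖ ≤ C * Real.exp (-(2 * Real.pi * ρ * |x|))

theorem ExpDecay.integrable {f : ℝ → ℂ} {ρ : ℝ} (hf : ExpDecay f ρ) {t : ℂ} (ht : |t.im| < ρ) :
    Integrable fun x : ℝ => f x * planeWave t x := by
  obtain ⟨C, hC, hb⟩ := hf.bound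
  have hc : 0 < 2 * Real.pi * (ρ - |t.im|) := by
    have := Real.pi_pos
    have := sub_pos.2 ht
    positivity
  refine Integrable.mono' ((integrable_exp_neg_mul_abs hc).const_mul C) ?_
    (Eventually.of_forall fun x => ?_)
  · refine (hf.continuous.mul ?_).aestronglyMeasurable
    unfold planeWave
    fun_prop
  · rw [norm_mul]
    calc _ ≤ C * Real.exp (-(2 * Real.pi * ρ * |x|)) * Real.exp (2 * Real.pi * |t.im| * |x|) :=
          mul_le_mul (hb x) (norm_planeWave_le t x) (norm_nonneg _) (by positivity)
      _ = _ := by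
          rw [mul_assoc, ← Real.exp_add]
          ring_nf

theorem ExpDecay.differentiableOn {f : ℝ → ℂ} {ρ : ℝ} (hf : ExpDecay f ρ) :
    DifferentiableOn ℂ (fun t => ∫ x : ℝ, f x * planeWave t x) {t | |t.im| < ρ} := by
  obtain ⟨C, hC, hb⟩ := hf.bound
  have hpw : Differentiable ℂ fun q : ℂ × ℂ => planeWave q.1 q.2 := by
    unfold planeWave; fun_prop
  refine differentiableOn_integral_of_dominated (isOpen_lt (by fun_prop) continuous_const)
    (fun t ht => (hf.integrable ht).aestronglyMeasurable) (Eventually.of_forall fun x => ?_)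
    fun t₀ ht₀ => ?_
  · have : Differentiable ℂ fun t : ℂ => planeWave t x :=
      hpw.comp (f := fun t : ℂ => (t, (x : ℂ))) (by fun_prop)
    fun_prop
  · obtain ⟨r, hr1, hr2⟩ := exists_between (show |t₀.im| < ρ from ht₀)
    have hc : 0 < 2 * Real.pi * (ρ - r) := by
      have := Real.pi_pos
      have := sub_pos.2 hr2
      positivity
    refine ⟨fun x => C * Real.exp (-(2 * Real.pi * (ρ - r) * |x|)),
      (integrable_exp_neg_mul_abs hc).const_mul C, {t | |t.im| < r},
      (isOpen_lt (by fun_prop) continuous_const).mem_nhds hr1,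
      Eventually.of_forall fun x t ht => ?_⟩
    have ht' : |t.im| ≤ r := le_of_lt ht
    rw [norm_mul]
    calc _ ≤ C * Real.exp (-(2 * Real.pi * ρ * |x|)) * Real.exp (2 * Real.pi * |t.im| * |x|) :=
          mul_le_mul (hb x) (norm_planeWave_le t x) (norm_nonneg _) (by positivity)
      _ ≤ C * Real.exp (-(2 * Real.pi * ρ * |x|)) * Real.exp (2 * Real.pi * r * |x|) := by
          have := Real.pi_pos
          gcongr
      _ = _ := by
          rw [mul_assoc, ← Real.exp_add]
          ring_nf

/-- The Fourier transform of the pair product, in the variable scaled by `p`. -/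
def hypFourier (G : ℂ → ℂ) (z p s : ℂ) : ℂ := ∫ x : ℝ, hypPair G z x * planeWave (s / p) x

theorem IsHypGamma.hypPair_growth {op om : ℂ} {G : ℂ → ℂ} (h : IsHypGamma op om G)
    (hop : 0 < op.re) (hom : 0 < om.re) {z : ℂ} {b : ℝ} (hz : -((op + om) / 2).re < z.im - b) :
    ∃ C : ℝ, 0 ≤ C ∧ ∀ v : ℂ, |v.im| ≤ b → ‖hypPair G z v‖ ≤ Real.exp (C * (1 + ‖v‖) ^ 3) := by
  obtain ⟨C, hC, hb⟩ := h.growth hop hom hz (z.im + b)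
  refine ⟨2 * C * (1 + ‖z‖) ^ 3, by positivity, fun v hv => ?_⟩
  obtain ⟨h1, h2⟩ := abs_le.1 hv
  have key : ∀ w : ℂ, ‖w‖ = ‖v‖ → |w.im| ≤ b →
      ‖G (w + z)‖ ≤ Real.exp (C * (1 + ‖z‖) ^ 3 * (1 + ‖v‖) ^ 3) := by
    intro w hw hwb
    obtain ⟨h1, h2⟩ := abs_le.1 hwb
    refine (hb _ (by rw [Complex.add_im]; linarith) (by rw [Complex.add_im]; linarith)).trans
      (Real.exp_le_exp.2 ?_)
    rw [mul_assoc, ← mul_pow]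
    gcongr
    have := norm_add_le w z
    rw [hw] at this
    nlinarith [mul_nonneg (norm_nonneg z) (norm_nonneg v)]
  rw [hypPair, norm_mul]
  calc _ ≤ Real.exp (C * (1 + ‖z‖) ^ 3 * (1 + ‖v‖) ^ 3) *
        Real.exp (C * (1 + ‖z‖) ^ 3 * (1 + ‖v‖) ^ 3) := by
        gcongr
        · exact key v rfl hv
        · exact key (-v) (norm_neg v) (by simpa using hv)
    _ = _ := by
        rw [← Real.exp_add]
        ring_nf

theorem norm_planeWave_le_growth (t v : ℂ) :
    ‖planeWave t v‖ ≤ Real.exp (2 * Real.pi * ‖t‖ * (1 + ‖v‖) ^ 3) := by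
  refine (norm_exp_le_exp_abs_re _).trans (Real.exp_le_exp.2 ((Complex.abs_re_le_norm _).trans ?_))
  rw [norm_mul, norm_mul, norm_mul, norm_mul, Complex.norm_I, Complex.norm_real,
    Real.norm_of_nonneg Real.pi_pos.le, Complex.norm_ofNat, mul_one]
  have h1 : (1:ℝ) ≤ 1 + ‖v‖ := by linarith [norm_nonneg v]
  have h2 : ‖v‖ ≤ (1 + ‖v‖) ^ 3 := by
    have := pow_le_pow_right₀ h1 (show 1 ≤ 3 by norm_num)
    linarith
  have := Real.pi_pos
  gcongr

/-- The difference equation satisfied by the Fourier transform of the pair product. -/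
theorem IsHypGamma.hypFourier_shift {op om : ℂ} {G : ℂ → ℂ} (h : IsHypGamma op om G)
    (hop : 0 < op.re) (hom : 0 < om.re) {z s : ℂ} {ρ : ℝ} (hz : -((op + om) / 2).re < z.im)
    (hdec : ExpDecay (fun x : ℝ => hypPair G z x) ρ)
    (hs₁ : |((s - I * om / 2) / (op * om)).im| < ρ)
    (hs₂ : |((s + I * om / 2) / (op * om)).im| < ρ) :
    hypFourier G z (op * om) (s - I * om / 2) *
        Complex.sinh (Real.pi * (z + I * om / 2) / op - Real.pi * s / op) =
      hypFourier G z (op * om) (s + I * om / 2) *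
        Complex.sinh (Real.pi * (z + I * om / 2) / op + Real.pi * s / op) := by
  have hopn : op ≠ 0 := fun h => by simp [h] at hop
  have homn : om ≠ 0 := fun h => by simp [h] at hom
  set d := Real.pi * (z + I * om / 2) / op with hd
  set e := Real.pi * s / op with he
  set Φ : ℝ → ℂ := fun x => hypPair G z x with hΦ
  set f : ℂ → ℂ := fun v => hypPair G (z + I * om / 2) v * planeWave (s / (op * om)) v with hf
  have i1 := hdec.integrable hs₁
  have i2 := hdec.integrable hs₂
  have wave : ∀ x u : ℂ, planeWave (s / (op * om)) (x + u * (I * om / 2))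
      = planeWave (s / (op * om)) x * Complex.exp (-(u * e)) := by
    intro x u
    rw [planeWave, planeWave, ← Complex.exp_add, he]
    congr 1
    field_simp
    linear_combination (u * s * om) * Complex.I_mul_I
  have w1 : ∀ x : ℂ, planeWave ((s - I * om / 2) / (op * om)) x
      = planeWave (s / (op * om)) x * Complex.exp (Real.pi * x / op) := by
    intro x
    rw [planeWave, planeWave, ← Complex.exp_add]
    congr 1
    field_simp
    linear_combination (-om * x) * Complex.I_mul_I
  have w2 : ∀ x : ℂ, planeWave ((s + I * om / 2) / (op * om)) x
      = planeWave (s / (op * om)) x * Complex.exp (-(Real.pi * x / op)) := by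
    intro x
    rw [planeWave, planeWave, ← Complex.exp_add]
    congr 1
    field_simp
    linear_combination (om * x) * Complex.I_mul_I
  have fup : ∀ x : ℝ, f (x + I * om / 2) = Complex.exp (-e) * (Complex.exp d *
      (Φ x * planeWave ((s - I * om / 2) / (op * om)) x) + Complex.exp (-d) *
      (Φ x * planeWave ((s + I * om / 2) / (op * om)) x)) := by
    intro x
    have e1 : hypPair G (z + I * om / 2) (x + I * om / 2)
        = 2 * Complex.cosh (Real.pi * x / op + d) * Φ x := by
      have := h.add_om hop hom (z := (x:ℂ) + z) (by simpa using hz)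
      simp only [hΦ, hypPair]
      rw [show (x:ℂ) + I * om / 2 + (z + I * om / 2) = x + z + I * om by ring, this,
        show -((x:ℂ) + I * om / 2) + (z + I * om / 2) = -x + z by ring, hd]
      ring_nf
    have e2 := wave x 1
    rw [one_mul, one_mul] at e2
    rw [hf]
    simp only
    rw [e1, e2, w1, w2, Complex.cosh, neg_add, Complex.exp_add, Complex.exp_add]
    ring
  have fdn : ∀ x : ℝ, f (x + -(I * om / 2)) = Complex.exp e * (Complex.exp (-d) *
      (Φ x * planeWave ((s - I * om / 2) / (op * om)) x) + Complex.exp d *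
      (Φ x * planeWave ((s + I * om / 2) / (op * om)) x)) := by
    intro x
    have e1 : hypPair G (z + I * om / 2) (x + -(I * om / 2))
        = 2 * Complex.cosh (-(Real.pi * x / op) + d) * Φ x := by
      have := h.add_om hop hom (z := -(x:ℂ) + z) (by simpa using hz)
      simp only [hΦ, hypPair]
      rw [show -((x:ℂ) + -(I * om / 2)) + (z + I * om / 2) = -x + z + I * om by ring,
        this, show ((x:ℂ) + -(I * om / 2)) + (z + I * om / 2) = x + z by ring, hd]
      ring_nf
    have e2 := wave x (-1)
    rw [neg_one_mul, neg_one_mul, neg_neg] at e2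
    rw [hf]
    simp only
    rw [e1, e2, w1, w2, Complex.cosh, neg_add, neg_neg, Complex.exp_add, Complex.exp_add]
    ring
  have hre : ((op + om) / 2).re = (op.re + om.re) / 2 := by simp
  have him : (I * om / 2).im = om.re / 2 := by simp
  have hshift : ∫ x : ℝ, f (x + -(I * om / 2)) = ∫ x : ℝ, f (x + I * om / 2) := by
    have hstrip : ∀ v : ℂ, (-(I * om / 2)).im ≤ v.im → v.im ≤ (I * om / 2).im →
        |v.im| ≤ om.re / 2 := fun v h1 h2 => by
      rw [Complex.neg_im, him] at h1
      rw [him] at h2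
      exact abs_le.2 ⟨h1, h2⟩
    have hzim : (z + I * om / 2).im = z.im + om.re / 2 := by rw [Complex.add_im, him]
    refine integral_eq_of_strip ?_ (fun v h1 h2 => ?_) ?_ ?_ ?_
    · rw [Complex.neg_im, him]; linarith
    · obtain ⟨h3, h4⟩ := abs_le.1 (hstrip v h1 h2)
      refine (h.hypPair_differentiableAt hop hom ?_ ?_).mul ?_
      · rw [Complex.add_im, hzim]; linarith
      · rw [Complex.add_im, hzim, Complex.neg_im]; linarith
      · unfold planeWave; fun_prop
    · obtain ⟨C, hC, hb⟩ := h.hypPair_growth hop hom (z := z + I * om / 2) (b := om.re / 2)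
        (by rw [hzim]; linarith)
      refine ⟨C + 2 * Real.pi * ‖s / (op * om)‖, by have := Real.pi_pos; positivity,
        fun v h1 h2 => ?_⟩
      rw [hf, norm_mul, add_mul, Real.exp_add]
      exact mul_le_mul (hb v (hstrip v h1 h2)) (norm_planeWave_le_growth _ _) (norm_nonneg _)
        (Real.exp_pos _).le
    · simp only [fdn]
      exact ((i1.const_mul _).add (i2.const_mul _)).const_mul _
    · simp only [fup]
      exact ((i1.const_mul _).add (i2.const_mul _)).const_mul _
  simp only [fdn, fup] at hshift
  rw [integral_const_mul, integral_const_mul, integral_add (i1.const_mul _) (i2.const_mul _),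
    integral_add (i1.const_mul _) (i2.const_mul _), integral_const_mul, integral_const_mul,
    integral_const_mul, integral_const_mul] at hshift
  rw [show hypFourier G z (op * om) (s - I * om / 2)
      = ∫ x : ℝ, Φ x * planeWave ((s - I * om / 2) / (op * om)) x from rfl,
    show hypFourier G z (op * om) (s + I * om / 2)
      = ∫ x : ℝ, Φ x * planeWave ((s + I * om / 2) / (op * om)) x from rfl,
    Complex.sinh, Complex.sinh, show -(d - e) = -d + e by ring, show -(d + e) = -d + -e by ring,
    sub_eq_add_neg d e, Complex.exp_add, Complex.exp_add, Complex.exp_add, Complex.exp_add]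
  linear_combination (-1 / 2 : ℂ) * hshift

/-! ### A doubly periodic function -/

theorem hypPair_expDecay {G : ℂ → ℂ → ℂ → ℂ}
    (hG : ∀ a b : ℂ, 0 < a.re → 0 < b.re → IsHypGamma a b (G a b)) {op om k : ℂ}
    (hop : 0 < op.re) (hom : 0 < om.re) (hk : k.re < 0) :
    ExpDecay (fun x : ℝ => hypPair (G op om) (-(I * (k + (op + om) / 2))) x)
      ((k + (op + om) / 2) / (op * om)).re := by
  have hz : -((op + om) / 2).re < (-(I * (k + (op + om) / 2))).im := by
    rw [Complex.neg_im, Complex.I_mul_im, Complex.add_re]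
    linarith
  refine ⟨(hG op om hop hom).continuous_hypPair hop hom hz, ?_⟩
  obtain ⟨C, hC, hb⟩ := hypPair_bound_single hG hop hom hz
  refine ⟨C, hC, fun x => ?_⟩
  rw [show (k + (op + om) / 2) / (op * om) = I * (-(I * (k + (op + om) / 2)) / (op * om)) by
    linear_combination ((k + (op + om) / 2) / (op * om)) * Complex.I_mul_I]
  exact hb x

/-- The Fourier transform of the weight times the dual pair product. -/
def cmProduct (G : ℂ → ℂ) (op om k s : ℂ) : ℂ :=
  hypFourier G (-(I * (k + (op + om) / 2))) (op * om) s * hypPair G (-(I * k)) s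

/-- The domain on which `cmProduct` is studied. -/
def cmStrip (op om k : ℂ) : Set ℂ :=
  {s | |(s / (op * om)).im| < ((k + (op + om) / 2) / (op * om)).re ∧
    |s.im| < ((op + om) / 2).re - k.re}

theorem cmProduct_comm (G : ℂ → ℂ) (op om k s : ℂ) :
    cmProduct G om op k s = cmProduct G op om k s := by
  rw [cmProduct, cmProduct, add_comm om op, mul_comm om op]

theorem cmStrip_comm (op om k : ℂ) : cmStrip om op k = cmStrip op om k := by
  rw [cmStrip, cmStrip, add_comm om op, mul_comm om op]

theorem isOpen_cmStrip (op om k : ℂ) : IsOpen (cmStrip op om k) :=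
  (isOpen_lt (f := fun s : ℂ => |(s / (op * om)).im|) (by fun_prop) continuous_const).inter
    (isOpen_lt (f := fun s : ℂ => |s.im|) (by fun_prop) continuous_const)

theorem convex_cmStrip (op om k : ℂ) : Convex ℝ (cmStrip op om k) := by
  have key : ∀ (c : ℂ) (r : ℝ), Convex ℝ {s : ℂ | |(s / c).im| < r} := by
    intro c r
    have h : IsLinearMap ℝ fun s : ℂ => (s / c).im :=
      ⟨fun x y => by rw [add_div, Complex.add_im], fun a x => by
        rw [Complex.real_smul, mul_div_assoc, Complex.im_ofReal_mul, smul_eq_mul]⟩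
    have h2 : {s : ℂ | |(s / c).im| < r} = {s : ℂ | (s / c).im < r} ∩ {s | -r < (s / c).im} := by
      ext s
      simp only [mem_ofPred_eq, mem_inter_iff, abs_lt]
      tauto
    rw [h2]
    exact (convex_halfSpace_lt h r).inter (convex_halfSpace_gt h (-r))
  have h1 := key 1 (((op + om) / 2).re - k.re)
  simp only [div_one] at h1
  exact (key _ _).inter h1

theorem IsHypGamma.cmProduct_differentiableOn {op om k : ℂ} {G : ℂ → ℂ} (h : IsHypGamma op om G)
    (hop : 0 < op.re) (hom : 0 < om.re)
    (hdec : ExpDecay (fun x : ℝ => hypPair G (-(I * (k + (op + om) / 2))) x)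
      ((k + (op + om) / 2) / (op * om)).re) :
    DifferentiableOn ℂ (cmProduct G op om k) (cmStrip op om k) := by
  intro s hs
  obtain ⟨hs1, hs2⟩ := hs
  obtain ⟨h3, h4⟩ := abs_lt.1 hs2
  have hopen : IsOpen {t : ℂ | |t.im| < ((k + (op + om) / 2) / (op * om)).re} :=
    isOpen_lt (by fun_prop) continuous_const
  have hF : DifferentiableAt ℂ (hypFourier G (-(I * (k + (op + om) / 2))) (op * om)) s :=
    (hdec.differentiableOn.differentiableAt (hopen.mem_nhds hs1)).comp
      (f := fun s => s / (op * om)) s (by fun_prop)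
  refine (hF.mul (h.hypPair_differentiableAt hop hom ?_ ?_)).differentiableWithinAt
  · simp only [Complex.add_im, Complex.neg_im, Complex.I_mul_im]
    linarith
  · simp only [Complex.add_im, Complex.neg_im, Complex.I_mul_im]
    linarith

theorem IsHypGamma.cmProduct_shift {op om k s : ℂ} {G : ℂ → ℂ} (h : IsHypGamma op om G)
    (hop : 0 < op.re) (hom : 0 < om.re) (hk : k.re < 0)
    (hdec : ExpDecay (fun x : ℝ => hypPair G (-(I * (k + (op + om) / 2))) x)
      ((k + (op + om) / 2) / (op * om)).re)
    (hs : s ∈ cmStrip op om k) (hs' : s + I * om ∈ cmStrip op om k) :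
    cmProduct G op om k (s + I * om) = cmProduct G op om k s := by
  have hopn : op ≠ 0 := fun h => by simp [h] at hop
  obtain ⟨σ, rfl⟩ : ∃ σ, s = σ - I * om / 2 := ⟨s + I * om / 2, by ring⟩
  rw [show σ - I * om / 2 + I * om = σ + I * om / 2 by ring] at hs' ⊢
  have hz : -((op + om) / 2).re < (-(I * (k + (op + om) / 2))).im := by
    rw [Complex.neg_im, Complex.I_mul_im, Complex.add_re]
    linarith
  have hF := h.hypFourier_shift hop hom hz hdec hs.1 hs'.1
  have hsinh : ∀ u : ℂ, Complex.sinh (u - Real.pi / 2 * I) = -I * Complex.cosh u := fun u => by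
    rw [Complex.sinh_sub, Complex.sinh_mul_I, Complex.cosh_mul_I, Complex.cos_pi_div_two,
      Complex.sin_pi_div_two]
    ring
  rw [show Real.pi * (-(I * (k + (op + om) / 2)) + I * om / 2) / op - Real.pi * σ / op
      = -(Real.pi * (σ + I * k) / op) - Real.pi / 2 * I by field_simp; ring,
    show Real.pi * (-(I * (k + (op + om) / 2)) + I * om / 2) / op + Real.pi * σ / op
      = Real.pi * (σ - I * k) / op - Real.pi / 2 * I by field_simp; ring, hsinh, hsinh,
    Complex.cosh_neg] at hF
  have hB1 := h.add_om hop hom (z := -(σ + I * om / 2) + -(I * k)) (by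
    have := (abs_lt.1 hs'.2).2
    simp only [Complex.add_im, Complex.neg_im, Complex.I_mul_im] at this ⊢
    linarith)
  have hB2 := h.add_om hop hom (z := σ - I * om / 2 + -(I * k)) (by
    have := (abs_lt.1 hs.2).1
    simp only [Complex.add_im, Complex.neg_im, Complex.I_mul_im] at this ⊢
    linarith)
  rw [show -(σ + I * om / 2) + -(I * k) + I * om = -(σ - I * om / 2) + -(I * k) by ring,
    show Real.pi * (-(σ + I * om / 2) + -(I * k) + I * om / 2) / op
      = -(Real.pi * (σ + I * k) / op) by ring, Complex.cosh_neg] at hB1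
  rw [show σ - I * om / 2 + -(I * k) + I * om = σ + I * om / 2 + -(I * k) by ring,
    show Real.pi * (σ - I * om / 2 + -(I * k) + I * om / 2) / op
      = Real.pi * (σ - I * k) / op by ring] at hB2
  rw [cmProduct, cmProduct, hypPair, hypPair, hB1, hB2]
  have hF' := mul_left_cancel₀ (neg_ne_zero.2 Complex.I_ne_zero)
    (show -I * (hypFourier G (-(I * (k + (op + om) / 2))) (op * om) (σ - I * om / 2) *
        Complex.cosh (Real.pi * (σ + I * k) / op)) =
      -I * (hypFourier G (-(I * (k + (op + om) / 2))) (op * om) (σ + I * om / 2) *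
        Complex.cosh (Real.pi * (σ - I * k) / op)) by linear_combination hF)
  linear_combination (-2 * G (σ - I * om / 2 + -(I * k)) *
    G (-(σ + I * om / 2) + -(I * k))) * hF'

/-! ### Doubly periodic holomorphic functions -/

theorem exists_real_coordinates {a b : ℂ} (hab : (a / b).im ≠ 0) :
    ∃ x y : ℂ → ℝ, Continuous x ∧ Continuous y ∧ (∀ s, s = x s * a + y s * b) ∧
      (∀ u v : ℝ, x (u * a + v * b) = u ∧ y (u * a + v * b) = v) := by
  have hb : b ≠ 0 := fun h => by simp [h] at hab
  have hx : Continuous fun s : ℂ => (s / b).im / (a / b).im := by fun_prop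
  refine ⟨fun s => (s / b).im / (a / b).im,
    fun s => (s / b).re - (s / b).im / (a / b).im * (a / b).re, hx, by fun_prop, fun s => ?_,
    fun u v => ?_⟩
  · have key : s / b = ((s / b).im / (a / b).im : ℝ) * (a / b) +
        ((s / b).re - (s / b).im / (a / b).im * (a / b).re : ℝ) := by
      apply Complex.ext
      · rw [Complex.add_re, Complex.re_ofReal_mul, Complex.ofReal_re]
        ring
      · rw [Complex.add_im, Complex.im_ofReal_mul, Complex.ofReal_im]
        field_simp
        ring
    have h2 : s = s / b * b := by field_simp
    conv_lhs => rw [h2, key]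
    field_simp
  · have h2 : (u * a + v * b) / b = u * (a / b) + v := by field_simp
    simp only [h2, Complex.add_im, Complex.add_re, Complex.im_ofReal_mul, Complex.re_ofReal_mul,
      Complex.ofReal_im, Complex.ofReal_re]
    constructor
    · field_simp
      ring
    · field_simp
      ring

theorem exists_sub_int_unit {x δ : ℝ} (hδ : δ ≤ 1 / 2) (hx : |x| < 1 / 2 + δ) :
    ∃ e : ℝ, (e = 0 ∨ e = 1 ∨ e = -1) ∧ |x - e| ≤ 1 / 2 := by
  obtain ⟨h1, h2⟩ := abs_lt.1 hx
  rcases le_or_gt x (1 / 2) with h3 | h3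
  · rcases le_or_gt (-1 / 2) x with h4 | h4
    · exact ⟨0, by simp, abs_le.2 ⟨by linarith, by linarith⟩⟩
    · exact ⟨-1, by simp, abs_le.2 ⟨by linarith, by linarith⟩⟩
  · exact ⟨1, by simp, abs_le.2 ⟨by linarith, by linarith⟩⟩

/-- A holomorphic function on a convex open set containing a neighbourhood of a period
parallelogram, which is doubly periodic inside that set, is constant. -/
theorem eq_of_doubly_periodic {f : ℂ → ℂ} {U : Set ℂ} {a b : ℂ} {δ : ℝ} (hU : IsOpen U)
    (hconv : Convex ℝ U) (hab : (a / b).im ≠ 0) (hδ0 : 0 < δ) (hδ : δ ≤ 1 / 2)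
    (hf : DifferentiableOn ℂ f U) (ha : ∀ s ∈ U, s + a ∈ U → f (s + a) = f s)
    (hb : ∀ s ∈ U, s + b ∈ U → f (s + b) = f s)
    (hsub : ∀ x y : ℝ, |x| < 1 / 2 + δ → |y| < 1 / 2 + δ → (x * a + y * b : ℂ) ∈ U)
    {s t : ℂ} (hs : s ∈ U) (ht : t ∈ U) : f s = f t := by
  obtain ⟨X, Y, hX, hY, hXY, hcoord⟩ := exists_real_coordinates hab
  set P : Set ℂ := Set.image (fun q : ℝ × ℝ => (q.1 * a + q.2 * b : ℂ))
    (Icc (-(1 / 2)) (1 / 2) ×ˢ Icc (-(1 / 2)) (1 / 2)) with hP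
  have hPmem : ∀ x y : ℝ, |x| ≤ 1 / 2 → |y| ≤ 1 / 2 → (x * a + y * b : ℂ) ∈ P := fun x y h1 h2 =>
    ⟨(x, y), ⟨abs_le.1 h1, abs_le.1 h2⟩, rfl⟩
  have hPc : IsCompact P := (isCompact_Icc.prod isCompact_Icc).image (by fun_prop)
  have hPU : ∀ s ∈ P, s ∈ U ∧ |X s| < 1 / 2 + δ ∧ |Y s| < 1 / 2 + δ := by
    rintro s ⟨q, ⟨h1, h2⟩, rfl⟩
    obtain ⟨h3, h4⟩ := hcoord q.1 q.2
    simp only [h3, h4]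
    have h5 : |q.1| < 1 / 2 + δ := by linarith [abs_le.2 h1]
    have h6 : |q.2| < 1 / 2 + δ := by linarith [abs_le.2 h2]
    exact ⟨hsub _ _ h5 h6, h5, h6⟩
  obtain ⟨s₀, hs₀, hmax⟩ := hPc.exists_isMaxOn ⟨_, hPmem 0 0 (by norm_num) (by norm_num)⟩
    (hf.continuousOn.mono fun s hs => (hPU s hs).1).norm
  have shift : ∀ c : ℂ, (∀ s ∈ U, s + c ∈ U → f (s + c) = f s) → ∀ e : ℝ,
      (e = 0 ∨ e = 1 ∨ e = -1) → ∀ s ∈ U, s - e * c ∈ U → f (s - e * c) = f s := by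
    intro c hc e he s hs hs'
    rcases he with rfl | rfl | rfl
    · simp
    · have := hc _ hs' (by simpa using hs)
      simpa using this.symm
    · have := hc _ hs (by simpa using hs')
      simpa using this
  have hle : ∀ x y : ℝ, |x| < 1 / 2 + δ → |y| < 1 / 2 + δ → ‖f (x * a + y * b)‖ ≤ ‖f s₀‖ := by
    intro x y hx hy
    obtain ⟨e, he, hxe⟩ := exists_sub_int_unit hδ hx
    obtain ⟨e', he', hye⟩ := exists_sub_int_unit hδ hy
    have hx' : |x - e| < 1 / 2 + δ := by linarith
    have hy' : |y - e'| < 1 / 2 + δ := by linarith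
    have h1 := shift a ha e he _ (hsub x y hx hy) (by
      convert hsub (x - e) y hx' hy using 1; push_cast; ring)
    have h2 := shift b hb e' he' _ (hsub (x - e) y hx' hy) (by
      convert hsub (x - e) (y - e') hx' hy' using 1; push_cast; ring)
    have h3 := hmax (hPmem (x - e) (y - e') hxe hye)
    have e1 : (x * a + y * b : ℂ) - e * a = ((x - e : ℝ) : ℂ) * a + y * b := by push_cast; ring
    have e2 : ((x - e : ℝ) : ℂ) * a + y * b - e' * b
        = ((x - e : ℝ) : ℂ) * a + ((y - e' : ℝ) : ℂ) * b := by push_cast; ring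
    rw [e1] at h1
    rw [e2] at h2
    rw [← h1, ← h2]
    exact h3
  have hloc : IsLocalMax (norm ∘ f) s₀ := by
    have h1 := (hX.abs.continuousAt (x := s₀)).eventually_lt
      (continuousAt_const (y := 1 / 2 + δ)) (hPU s₀ hs₀).2.1
    have h2 := (hY.abs.continuousAt (x := s₀)).eventually_lt
      (continuousAt_const (y := 1 / 2 + δ)) (hPU s₀ hs₀).2.2
    filter_upwards [h1, h2] with s hs1 hs2
    have := hle _ _ hs1 hs2
    rwa [← hXY] at this
  have hdiff : ∀ᶠ z in 𝓝 s₀, DifferentiableAt ℂ f z :=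
    hf.eventually_differentiableAt (hU.mem_nhds (hPU s₀ hs₀).1)
  have hev := Complex.eventually_eq_of_isLocalMax_norm hdiff hloc
  have := (hf.analyticOnNhd hU).eqOn_of_preconnected_of_eventuallyEq
    (analyticOnNhd_const (v := f s₀)) hconv.isPreconnected (hPU s₀ hs₀).1 hev
  rw [this hs, this ht]

theorem mem_cmStrip_of_abs_lt {op om k : ℂ} (hop : 0 < op.re) (hom : 0 < om.re) {δ : ℝ}
    (h1 : 2 * δ * ((op + om) / 2).re ≤ -k.re)
    (h2 : 2 * δ * ((op + om) / 2 / (op * om)).re ≤ (k / (op * om)).re) {x y : ℝ}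
    (hx : |x| < 1 / 2 + δ) (hy : |y| < 1 / 2 + δ) :
    (x * (I * op) + y * (I * om) : ℂ) ∈ cmStrip op om k := by
  have hopn : op ≠ 0 := fun h => by simp [h] at hop
  have homn : om ≠ 0 := fun h => by simp [h] at hom
  have key : ∀ u v : ℝ, 0 < u → 0 < v → |x * u + y * v| < (1 / 2 + δ) * (u + v) := by
    intro u v hu hv
    refine (abs_add_le _ _).trans_lt ?_
    rw [abs_mul, abs_mul, abs_of_pos hu, abs_of_pos hv]
    nlinarith
  have hω : ((op + om) / 2 / (op * om)).re = ((1 / op).re + (1 / om).re) / 2 := by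
    rw [show (op + om) / 2 / (op * om) = (1 / op + 1 / om) / 2 by field_simp; ring]
    simp
  have hW : ((op + om) / 2).re = (op.re + om.re) / 2 := by simp
  constructor
  · have e : ((x * (I * op) + y * (I * om)) / (op * om)).im
        = x * (1 / om).re + y * (1 / op).re := by
      rw [show (x * (I * op) + y * (I * om)) / (op * om) = I * (x * (1 / om) + y * (1 / op)) by
        field_simp, Complex.I_mul_im, Complex.add_re, Complex.re_ofReal_mul,
        Complex.re_ofReal_mul]
    rw [e, add_div k, Complex.add_re]
    have := key _ _ (re_inv_pos hom) (re_inv_pos hop)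
    rw [hω] at h2 ⊢
    linarith
  · have e : (x * (I * op) + y * (I * om) : ℂ).im = x * op.re + y * om.re := by
      rw [Complex.add_im, Complex.im_ofReal_mul, Complex.im_ofReal_mul, Complex.I_mul_im,
        Complex.I_mul_im]
    rw [e]
    have := key _ _ hop hom
    rw [hW] at h1 ⊢
    linarith

theorem exists_cell_subset_cmStrip {op om k : ℂ} (hop : 0 < op.re) (hom : 0 < om.re)
    (hk : k.re < 0) (hkp : 0 < (k / (op * om)).re) :
    ∃ δ : ℝ, 0 < δ ∧ δ ≤ 1 / 2 ∧ ∀ x y : ℝ, |x| < 1 / 2 + δ → |y| < 1 / 2 + δ →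
      (x * (I * op) + y * (I * om) : ℂ) ∈ cmStrip op om k := by
  have hopn : op ≠ 0 := fun h => by simp [h] at hop
  have homn : om ≠ 0 := fun h => by simp [h] at hom
  have hW : 0 < ((op + om) / 2).re := by simp; linarith
  have hω : 0 < ((op + om) / 2 / (op * om)).re := by
    rw [show (op + om) / 2 / (op * om) = (1 / op + 1 / om) / 2 by field_simp; ring]
    have := re_inv_pos hop
    have := re_inv_pos hom
    simp only [Complex.div_ofNat_re, Complex.add_re]
    linarith
  set δ := min (1 / 2) (min (-k.re / (2 * ((op + om) / 2).re))
    ((k / (op * om)).re / (2 * ((op + om) / 2 / (op * om)).re))) with hδ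
  have hδ0 : 0 < δ := lt_min (by norm_num)
    (lt_min (div_pos (by linarith) (by linarith)) (div_pos hkp (by linarith)))
  have hδ2 : δ ≤ -k.re / (2 * ((op + om) / 2).re) := (min_le_right _ _).trans (min_le_left _ _)
  have hδ3 : δ ≤ (k / (op * om)).re / (2 * ((op + om) / 2 / (op * om)).re) :=
    (min_le_right _ _).trans (min_le_right _ _)
  rw [le_div_iff₀ (by linarith)] at hδ2 hδ3
  exact ⟨δ, hδ0, min_le_left _ _, fun x y hx hy =>
    mem_cmStrip_of_abs_lt hop hom (by linarith) (by linarith) hx hy⟩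

theorem IsHypGamma.cmProduct_eq {op om k : ℂ} {G : ℂ → ℂ} (h : IsHypGamma op om G)
    (hop : 0 < op.re) (hom : 0 < om.re) (hr : (op / om).im ≠ 0) (hk : k.re < 0)
    (hkp : 0 < (k / (op * om)).re)
    (hdec : ExpDecay (fun x : ℝ => hypPair G (-(I * (k + (op + om) / 2))) x)
      ((k + (op + om) / 2) / (op * om)).re) {s t : ℂ} (hs : s ∈ cmStrip op om k)
    (ht : t ∈ cmStrip op om k) : cmProduct G op om k s = cmProduct G op om k t := by
  obtain ⟨δ, hδ0, hδ, hcell⟩ := exists_cell_subset_cmStrip hop hom hk hkp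
  refine eq_of_doubly_periodic (a := I * op) (b := I * om) (isOpen_cmStrip op om k)
    (convex_cmStrip op om k) ?_ hδ0 hδ
    (h.cmProduct_differentiableOn hop hom hdec) (fun s hs hs' => ?_)
    (fun s hs hs' => h.cmProduct_shift hop hom hk hdec hs hs') hcell hs ht
  · rwa [mul_div_mul_left _ _ Complex.I_ne_zero]
  · have := h.symm.cmProduct_shift (k := k) (s := s) hom hop hk
      (by rwa [add_comm om op, mul_comm om op]) (by rwa [cmStrip_comm]) (by rwa [cmStrip_comm])
    rwa [cmProduct_comm G op om, cmProduct_comm G op om] at this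

/-! ### Determination of the constant -/

theorem tendsto_mul_integral_exp {g : ℝ → ℂ} {C ρ : ℝ} (hg : Continuous g) (hρ : 0 < ρ)
    (h₁ : ∀ x, 0 ≤ x → ‖g x‖ ≤ C) (h₂ : ∀ x ≤ 0, ‖g x‖ ≤ C * Real.exp (4 * Real.pi * ρ * x))
    (hlim : Tendsto g atTop (𝓝 1)) :
    Tendsto (fun ε : ℝ => (ε : ℂ) * ∫ x : ℝ, g x * Complex.exp (-(2 * Real.pi * ε * x)))
      (𝓝[>] 0) (𝓝 (1 / (2 * Real.pi))) := by
  have hC : 0 ≤ C := (norm_nonneg _).trans (h₁ 0 le_rfl)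
  have hpi := Real.pi_pos
  have hfint : ∫ t : ℝ, (Ioi (0:ℝ)).indicator (fun t : ℝ => Complex.exp (-(2 * Real.pi * t))) t
      = 1 / (2 * Real.pi) := by
    rw [integral_indicator measurableSet_Ioi]
    have h := integral_exp_mul_complex_Ioi (a := -(2 * Real.pi)) (by simp [hpi]) 0
    simp only [neg_mul] at h
    rw [h]
    simp
  have hscale : ∀ ε : ℝ, 0 < ε → ∫ t : ℝ, g (t / ε) * Complex.exp (-(2 * Real.pi * t))
      = (ε : ℂ) * ∫ x : ℝ, g x * Complex.exp (-(2 * Real.pi * ε * x)) := by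
    intro ε hε
    have h := Measure.integral_comp_div
      (fun x : ℝ => g x * Complex.exp (-(2 * Real.pi * ε * x))) ε
    rw [abs_of_pos hε, Complex.real_smul] at h
    rw [← h]
    congr 1
    ext t
    congr 3
    push_cast
    have : (ε : ℂ) ≠ 0 := by exact_mod_cast hε.ne'
    field_simp
  rw [← hfint]
  have hev : ∀ᶠ ε : ℝ in 𝓝[>] 0, 0 < ε ∧ ε ≤ ρ := by
    filter_upwards [self_mem_nhdsWithin, mem_nhdsWithin_of_mem_nhds (Iic_mem_nhds hρ)] with ε h h'
    exact ⟨h, h'⟩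
  refine Tendsto.congr' (f₁ := fun ε : ℝ => ∫ t : ℝ, g (t / ε) * Complex.exp (-(2 * Real.pi * t)))
    (hev.mono fun ε h => hscale ε h.1) ?_
  refine tendsto_integral_filter_of_dominated_convergence
    (fun t => C * Real.exp (-(2 * Real.pi * |t|))) (hev.mono fun ε h => ?_) (hev.mono fun ε h => ?_)
    ((integrable_exp_neg_mul_abs (by positivity)).const_mul C) ?_
  · refine Continuous.aestronglyMeasurable ?_
    fun_prop
  · refine Eventually.of_forall fun t => ?_
    have hnorm : ‖Complex.exp (-(2 * Real.pi * t))‖ = Real.exp (-(2 * Real.pi * t)) := by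
      rw [Complex.norm_exp]
      congr 1
      rw [show -(2 * (Real.pi : ℂ) * t) = ((-(2 * Real.pi * t) : ℝ) : ℂ) by push_cast; ring,
        Complex.ofReal_re]
    rw [norm_mul, hnorm]
    rcases le_total 0 t with ht | ht
    · rw [abs_of_nonneg ht]
      gcongr
      exact h₁ _ (div_nonneg ht h.1.le)
    · rw [abs_of_nonpos ht]
      calc _ ≤ C * Real.exp (4 * Real.pi * ρ * (t / ε)) * Real.exp (-(2 * Real.pi * t)) := by
            gcongr
            exact h₂ _ (div_nonpos_of_nonpos_of_nonneg ht h.1.le)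
        _ ≤ C * Real.exp (4 * Real.pi * t) * Real.exp (-(2 * Real.pi * t)) := by
            gcongr C * Real.exp ?_ * _
            have h3 : t ≥ ρ * (t / ε) := by
              have h4 : 1 ≤ ρ / ε := (one_le_div h.1).2 h.2
              rw [show ρ * (t / ε) = t * (ρ / ε) by ring]
              nlinarith
            rw [mul_assoc (4 * Real.pi)]
            gcongr
        _ = _ := by
            rw [mul_assoc, ← Real.exp_add]
            ring_nf
  · have h0 : ∀ᵐ t : ℝ, t ≠ 0 := by simp [ae_iff]
    filter_upwards [h0] with t ht
    have hinv : Tendsto (fun ε : ℝ => ε⁻¹) (𝓝[>] 0) atTop := tendsto_inv_nhdsGT_zero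
    rcases lt_or_gt_of_ne ht with ht | ht
    · rw [indicator_of_notMem (by simpa using ht.le)]
      have hbot : Tendsto (fun ε : ℝ => 4 * Real.pi * ρ * (t / ε)) (𝓝[>] 0) atBot := by
        have := hinv.const_mul_atTop_of_neg (show 4 * Real.pi * ρ * t < 0 from
          mul_neg_of_pos_of_neg (by positivity) ht)
        refine this.congr fun ε => by ring
      have h3 : Tendsto (fun ε : ℝ => g (t / ε)) (𝓝[>] 0) (𝓝 0) := by
        refine squeeze_zero_norm' (a := fun ε : ℝ => C * Real.exp (4 * Real.pi * ρ * (t / ε)))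
          (hev.mono fun ε h => h₂ _ (div_nonpos_of_nonpos_of_nonneg ht.le h.1.le)) ?_
        simpa using (Real.tendsto_exp_atBot.comp hbot).const_mul C
      simpa using h3.mul_const (Complex.exp (-(2 * Real.pi * t)))
    · rw [indicator_of_mem (by simpa using ht)]
      have h3 : Tendsto (fun ε : ℝ => g (t / ε)) (𝓝[>] 0) (𝓝 1) :=
        hlim.comp (hinv.const_mul_atTop ht)
      simpa using h3.mul_const (Complex.exp (-(2 * Real.pi * t)))

theorem tendsto_mul_hypFourier {G : ℂ → ℂ → ℂ → ℂ}
    (hG : ∀ a b : ℂ, 0 < a.re → 0 < b.re → IsHypGamma a b (G a b)) {op om k : ℂ}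
    (hop : 0 < op.re) (hom : 0 < om.re) (hk : k.re < 0)
    (hβ : 0 < ((k + (op + om) / 2) / (op * om)).re) :
    Tendsto (fun ε : ℝ => (ε : ℂ) * hypFourier (G op om) (-(I * (k + (op + om) / 2))) (op * om)
      (-(I * (k + (op + om) / 2)) + I * ε * (op * om))) (𝓝[>] 0) (𝓝 (1 / (2 * Real.pi))) := by
  have hopn : op ≠ 0 := fun h => by simp [h] at hop
  have homn : om ≠ 0 := fun h => by simp [h] at hom
  have hdec := hypPair_expDecay hG hop hom hk
  have hz : -((op + om) / 2).re < (-(I * (k + (op + om) / 2))).im := by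
    rw [Complex.neg_im, Complex.I_mul_im, Complex.add_re]
    linarith
  set β := k + (op + om) / 2 with hβdef
  set ρ := (β / (op * om)).re with hρ
  obtain ⟨C, hC, hb⟩ := hdec.bound
  have hnorm : ∀ x : ℝ, ‖Complex.exp (2 * Real.pi * β / (op * om) * x)‖
      = Real.exp (2 * Real.pi * ρ * x) := fun x => by
    rw [Complex.norm_exp]
    congr 1
    rw [show 2 * (Real.pi : ℂ) * β / (op * om) * x
        = ((2 * Real.pi * x : ℝ) : ℂ) * (β / (op * om)) by push_cast; ring,
      Complex.re_ofReal_mul, ← hρ]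
    ring
  have hlim := tendsto_hypPair (hG op om hop hom) (hG 1 1 one_pos one_pos) hop hom hz
  refine (tendsto_mul_integral_exp (g := fun x : ℝ => hypPair (G op om) (-(I * β)) x *
    Complex.exp (2 * Real.pi * β / (op * om) * x)) (C := C) (hdec.continuous.mul (by fun_prop)) hβ
    (fun x hx => ?_) (fun x hx => ?_) (hlim.congr fun x => ?_)).congr fun ε => ?_
  · rw [norm_mul, hnorm]
    calc _ ≤ C * Real.exp (-(2 * Real.pi * ρ * |x|)) * Real.exp (2 * Real.pi * ρ * x) := by
          gcongr
          exact hb x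
      _ = C := by
          rw [abs_of_nonneg hx, mul_assoc, ← Real.exp_add]
          simp
  · rw [norm_mul, hnorm]
    calc _ ≤ C * Real.exp (-(2 * Real.pi * ρ * |x|)) * Real.exp (2 * Real.pi * ρ * x) := by
          gcongr
          exact hb x
      _ = _ := by
          rw [abs_of_nonpos hx, mul_assoc, ← Real.exp_add]
          ring_nf
  · congr 2
    linear_combination (-(2 * Real.pi * β / (op * om) * x)) * Complex.I_mul_I
  · congr 1
    rw [hypFourier]
    congr 1
    ext x
    rw [mul_assoc, ← Complex.exp_add, planeWave]
    congr 2
    field_simp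
    linear_combination (x * (β - ε * (op * om))) * Complex.I_mul_I

theorem IsHypGamma.add_om_imaginary {op om k : ℂ} {G : ℂ → ℂ} (h : IsHypGamma op om G)
    (hop : 0 < op.re) (hom : 0 < om.re) (hk : k.re < op.re) :
    G (I * ((op + om) / 2 - k)) =
      2 * Complex.sin (Real.pi * k / op) * G (I * ((op - om) / 2 - k)) := by
  have hopn : op ≠ 0 := fun h => by simp [h] at hop
  have h1 := h.add_om hop hom (z := I * ((op - om) / 2 - k)) (by
    simp only [Complex.I_mul_im, Complex.sub_re, Complex.add_re, Complex.div_ofNat_re]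
    linarith)
  rw [show I * ((op + om) / 2 - k) = I * ((op - om) / 2 - k) + I * om by ring, h1,
    show Real.pi * (I * ((op - om) / 2 - k) + I * om / 2) / op
      = (Real.pi / 2 - Real.pi * k / op) * I by field_simp; ring, Complex.cosh_mul_I,
    Complex.cos_pi_div_two_sub]

theorem IsHypGamma.tendsto_hypPair_div {op om k : ℂ} {G : ℂ → ℂ} (h : IsHypGamma op om G)
    (hop : 0 < op.re) (hom : 0 < om.re) (hk : k.re < 0) :
    Tendsto (fun ε : ℝ => hypPair G (-(I * k))
      (-(I * (k + (op + om) / 2)) + I * ε * (op * om)) / ε) (𝓝[>] 0)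
      (𝓝 (2 * Real.pi * (om * G (I * ((op - om) / 2)) * G (-(I * (2 * k + (op + om) / 2)))))) := by
  have hopn : op ≠ 0 := fun h => by simp [h] at hop
  have hT : ∀ F : ℝ → ℂ, ContinuousAt F 0 → Tendsto F (𝓝[>] 0) (𝓝 (F 0)) := fun F hF =>
    hF.tendsto.mono_left nhdsWithin_le_nhds
  have hsin : Tendsto (fun ε : ℝ => Complex.sin (Real.pi * om * ε) / ε) (𝓝[>] 0)
      (𝓝 (Real.pi * om)) := by
    have h1 : HasDerivAt (fun ε : ℂ => Complex.sin (Real.pi * om * ε)) (Real.pi * om) 0 := by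
      have := ((hasDerivAt_id (0:ℂ)).const_mul (Real.pi * om)).csin
      simpa using this
    have h2 := hasDerivAt_iff_tendsto_slope_zero.1 h1.comp_ofReal
    refine (h2.mono_left (nhdsWithin_mono _ fun x hx => ne_of_gt hx)).congr fun ε => ?_
    simp [div_eq_inv_mul]
  have c1 : Tendsto (fun ε : ℝ => G (I * ((op - om) / 2 - ε * (op * om)))) (𝓝[>] 0)
      (𝓝 (G (I * ((op - om) / 2)))) := by
    have := hT (fun ε : ℝ => G (I * ((op - om) / 2 - ε * (op * om)))) (ContinuousAt.comp
      (f := fun ε : ℝ => I * ((op - om) / 2 - ε * (op * om))) (h.continuousAt hop hom ?_)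
      (by fun_prop))
    · simpa using this
    · simp only [Complex.ofReal_zero, zero_mul, sub_zero, Complex.I_mul_im, Complex.sub_re,
        Complex.add_re, Complex.div_ofNat_re]
      linarith
  have c2 : Tendsto (fun ε : ℝ => G (-(I * (2 * k + (op + om) / 2)) + I * ε * (op * om))) (𝓝[>] 0)
      (𝓝 (G (-(I * (2 * k + (op + om) / 2))))) := by
    have := hT (fun ε : ℝ => G (-(I * (2 * k + (op + om) / 2)) + I * ε * (op * om)))
      (ContinuousAt.comp (f := fun ε : ℝ => -(I * (2 * k + (op + om) / 2)) + I * ε * (op * om))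
      (h.continuousAt hop hom ?_) (by fun_prop))
    · simpa using this
    · simp only [Complex.ofReal_zero, mul_zero, zero_mul, add_zero, Complex.neg_im,
        Complex.I_mul_im, Complex.add_re, Complex.div_ofNat_re, two_mul k]
      linarith
  have hev : ∀ᶠ ε : ℝ in 𝓝[>] 0, (ε * (op * om)).re < op.re := by
    have : ContinuousAt (fun ε : ℝ => (ε * (op * om)).re) 0 := by fun_prop
    exact nhdsWithin_le_nhds (this.eventually_lt continuousAt_const (by simpa using hop))
  have := ((hsin.mul c1).mul c2).const_mul 2
  rw [show 2 * (Real.pi * om * G (I * ((op - om) / 2)) * G (-(I * (2 * k + (op + om) / 2))))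
    = 2 * Real.pi * (om * G (I * ((op - om) / 2)) * G (-(I * (2 * k + (op + om) / 2)))) by ring]
    at this
  refine this.congr' (hev.mono fun ε hε => ?_)
  have e := h.add_om_imaginary hop hom hε
  rw [show (Real.pi : ℂ) * (ε * (op * om)) / op = Real.pi * om * ε by field_simp] at e
  simp only [hypPair]
  rw [show -(-(I * (k + (op + om) / 2)) + I * ε * (op * om)) + -(I * k)
    = I * ((op + om) / 2 - ε * (op * om)) by ring, e,
    show -(I * (k + (op + om) / 2)) + I * ε * (op * om) + -(I * k)
    = -(I * (2 * k + (op + om) / 2)) + I * ε * (op * om) by ring]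
  ring

theorem cmProduct_eq_const {G : ℂ → ℂ → ℂ → ℂ}
    (hG : ∀ a b : ℂ, 0 < a.re → 0 < b.re → IsHypGamma a b (G a b)) {op om k s : ℂ}
    (hop : 0 < op.re) (hom : 0 < om.re) (hr : (op / om).im ≠ 0) (hk : k.re < 0)
    (hkp : 0 < (k / (op * om)).re) (hs : s ∈ cmStrip op om k) :
    cmProduct (G op om) op om k s =
      om * G op om (I * ((op - om) / 2)) * G op om (-(I * (2 * k + (op + om) / 2))) := by
  have hopn : op ≠ 0 := fun h => by simp [h] at hop
  have homn : om ≠ 0 := fun h => by simp [h] at hom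
  have hβ : 0 < ((k + (op + om) / 2) / (op * om)).re := by
    rw [show (k + (op + om) / 2) / (op * om) = k / (op * om) + (1 / op + 1 / om) / 2 by
      field_simp; ring]
    have := re_inv_pos hop
    have := re_inv_pos hom
    simp only [Complex.div_ofNat_re, Complex.add_re]
    linarith
  have hW : 0 < ((op + om) / 2).re := by simp; linarith
  have hlim := (tendsto_mul_hypFourier hG hop hom hk hβ).mul
    ((hG op om hop hom).tendsto_hypPair_div hop hom hk)
  have hev : ∀ᶠ ε : ℝ in 𝓝[>] 0,
      0 < ε ∧ -(I * (k + (op + om) / 2)) + I * ε * (op * om) ∈ cmStrip op om k := by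
    have e1 : ∀ᶠ ε : ℝ in 𝓝[>] 0, ε < 2 * ((k + (op + om) / 2) / (op * om)).re :=
      nhdsWithin_le_nhds (gt_mem_nhds (by linarith))
    have e2 : ∀ᶠ ε : ℝ in 𝓝[>] 0,
        |(-(I * (k + (op + om) / 2)) + I * ε * (op * om)).im| < ((op + om) / 2).re - k.re := by
      have : ContinuousAt (fun ε : ℝ =>
        |(-(I * (k + (op + om) / 2)) + I * ε * (op * om)).im|) 0 := by fun_prop
      refine nhdsWithin_le_nhds (this.eventually_lt continuousAt_const ?_)
      simp only [Complex.ofReal_zero, mul_zero, zero_mul, add_zero, Complex.neg_im, Complex.I_mul_im,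
        Complex.add_re k]
      exact abs_lt.2 ⟨by linarith, by linarith⟩
    filter_upwards [e1, e2, self_mem_nhdsWithin] with ε h1 h2 h3
    have h3' : 0 < ε := h3
    refine ⟨h3, ?_, h2⟩
    rw [show (-(I * (k + (op + om) / 2)) + I * ε * (op * om)) / (op * om)
      = I * (ε - (k + (op + om) / 2) / (op * om)) by field_simp; ring, Complex.I_mul_im,
      Complex.sub_re, Complex.ofReal_re]
    exact abs_lt.2 ⟨by linarith, by linarith⟩
  have hconst := (tendsto_const_nhds (x := cmProduct (G op om) op om k s)).congr' (f₂ := fun ε : ℝ =>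
    (ε : ℂ) * hypFourier (G op om) (-(I * (k + (op + om) / 2))) (op * om)
      (-(I * (k + (op + om) / 2)) + I * ε * (op * om)) * (hypPair (G op om) (-(I * k))
      (-(I * (k + (op + om) / 2)) + I * ε * (op * om)) / ε)) (hev.mono fun ε h => by
    have hε : (ε : ℂ) ≠ 0 := by exact_mod_cast h.1.ne'
    rw [(hG op om hop hom).cmProduct_eq hop hom hr hk hkp (hypPair_expDecay hG hop hom hk) hs h.2,
      cmProduct]
    field_simp)
  rw [tendsto_nhds_unique hconst hlim]
  have hpi : (Real.pi : ℂ) ≠ 0 := by exact_mod_cast Real.pi_ne_zero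
  field_simp

theorem IsHypGamma.mul_eq_mul {op om : ℂ} {G : ℂ → ℂ} (h : IsHypGamma op om G)
    (hop : 0 < op.re) (hom : 0 < om.re) :
    om * G (I * ((op - om) / 2)) = op * G (I * ((om - op) / 2)) := by
  have hopn : op ≠ 0 := fun h => by simp [h] at hop
  have homn : om ≠ 0 := fun h => by simp [h] at hom
  have hpi : (Real.pi : ℂ) ≠ 0 := by exact_mod_cast Real.pi_ne_zero
  have hsin : ∀ c : ℂ, Tendsto (fun ε : ℝ => Complex.sin (Real.pi * ε / c) / ε) (𝓝[>] 0)
      (𝓝 (Real.pi / c)) := by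
    intro c
    have h1 : HasDerivAt (fun ε : ℂ => Complex.sin (Real.pi * ε / c)) (Real.pi / c) 0 := by
      have := (((hasDerivAt_id (0:ℂ)).const_mul (Real.pi : ℂ)).div_const c).csin
      simpa using this
    have h2 := hasDerivAt_iff_tendsto_slope_zero.1 h1.comp_ofReal
    refine (h2.mono_left (nhdsWithin_mono _ fun x hx => ne_of_gt hx)).congr fun ε => ?_
    simp [div_eq_inv_mul]
  have hlim : ∀ b : ℂ, -((op + om) / 2).re < b.re →
      Tendsto (fun ε : ℝ => G (I * (b - ε))) (𝓝[>] 0) (𝓝 (G (I * b))) := by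
    intro b hb
    have hc : ContinuousAt (fun ε : ℝ => G (I * (b - ε))) 0 := ContinuousAt.comp
      (f := fun ε : ℝ => I * (b - ε)) (h.continuousAt hop hom (by simpa using hb)) (by fun_prop)
    have := hc.tendsto.mono_left (nhdsWithin_le_nhds (s := Ioi 0))
    simpa using this
  have l1 := (hsin op).mul (hlim ((op - om) / 2) (by simp; linarith))
  have l2 := (hsin om).mul (hlim ((om - op) / 2) (by simp; linarith))
  have hev : ∀ᶠ ε : ℝ in 𝓝[>] 0, ε < op.re ∧ ε < om.re :=
    nhdsWithin_le_nhds ((gt_mem_nhds hop).and (gt_mem_nhds hom))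
  have heq := tendsto_nhds_unique (l1.congr' (hev.mono fun ε hε => ?_)) l2
  · rw [div_mul_eq_mul_div, div_mul_eq_mul_div, div_eq_div_iff hopn homn] at heq
    exact mul_left_cancel₀ hpi (by linear_combination heq)
  · have e1 := h.add_om_imaginary hop hom (k := ε) (by simpa using hε.1)
    have e2 := h.symm.add_om_imaginary hom hop (k := ε) (by simpa using hε.2)
    rw [add_comm om op, e1] at e2
    have := mul_left_cancel₀ (two_ne_zero (α := ℂ)) (by simpa only [mul_assoc] using e2)
    rw [div_mul_eq_mul_div, div_mul_eq_mul_div, this]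

theorem mul_mem_slitPlane {a b : ℂ} (ha : 0 < a.re) (hb : 0 < b.re) : a * b ∈ Complex.slitPlane := by
  rw [Complex.mem_slitPlane_iff]
  by_contra! hc
  obtain ⟨h1, h2⟩ := hc
  rw [Complex.mul_re] at h1
  rw [Complex.mul_im] at h2
  have h3 : a.re * (a.re * b.re - a.im * b.im) = b.re * (a.re ^ 2 + a.im ^ 2) := by
    linear_combination (-a.im) * h2
  have h4 : 0 < b.re * (a.re ^ 2 + a.im ^ 2) := by positivity
  nlinarith

/-- The value of the hyperbolic gamma function at `i(ω₊ - ω₋)/2`. -/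
theorem mul_hypGamma_half_sub {G : ℂ → ℂ → ℂ → ℂ}
    (hG : ∀ a b : ℂ, 0 < a.re → 0 < b.re → IsHypGamma a b (G a b)) {op om : ℂ}
    (hop : 0 < op.re) (hom : 0 < om.re) :
    om * G op om (I * ((op - om) / 2)) = (op * om) ^ ((1:ℂ) / 2) := by
  have hpre : IsPreconnected {a : ℂ | 0 < a.re} := (convex_halfSpace_re_gt 0).isPreconnected
  have homn : om ≠ 0 := fun h => by simp [h] at hom
  rw [one_div]
  refine hpre.eq_of_sq_eq (f := fun a => om * G a om (I * ((a - om) / 2)))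
    (g := fun a => (a * om) ^ ((2:ℂ)⁻¹)) ?_ ?_ ?_ ?_ (y := om) hom ?_ hop
  · intro a ha
    have hc := continuousAt_hypGamma_family hG (op := a) ha hom (z := I * ((a - om) / 2)) (by
      simp only [mem_ofPred_eq] at ha
      simp
      linarith)
    exact (continuousAt_const.mul (ContinuousAt.comp (f := fun a : ℂ => (a, I * ((a - om) / 2)))
      hc (by fun_prop))).continuousWithinAt
  · refine ContinuousOn.cpow (by fun_prop) continuousOn_const fun a ha => ?_
    exact mul_mem_slitPlane ha hom
  · intro a ha
    have h := hG a om ha hom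
    simp only [mem_ofPred_eq] at ha
    have h1 := h.mul_eq_mul ha hom
    have h2 := h.reflection_of_strip (z := I * ((a - om) / 2)) (by
      simp only [Complex.I_mul_im, Complex.add_re, Complex.sub_re, Complex.div_ofNat_re]
      exact abs_lt.2 ⟨by linarith, by linarith⟩)
    rw [show -(I * ((a - om) / 2)) = I * ((om - a) / 2) by ring] at h2
    simp only [Pi.pow_apply, Complex.cpow_ofNat_inv_pow]
    linear_combination (om * G a om (I * ((a - om) / 2))) * h1 + a * om * h2
  · intro a ha
    have han : a ≠ 0 := fun h => by simp [h] at ha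
    simp [Complex.cpow_eq_zero_iff, han, homn]
  · have harg := abs_lt.1 (Complex.abs_arg_lt_pi_div_two_iff.2 (Or.inl hom))
    have := Complex.pow_cpow_ofNat_inv (n := 2) (x := om) harg.1 harg.2.le
    simp only [sub_self, zero_div, mul_zero, (hG om om hom hom).zero hom hom, mul_one]
    rw [← pow_two]
    exact this.symm

/-! ### Evaluation of the integral -/

theorem IsHypGamma.hypPair_half_add {op om : ℂ} {G : ℂ → ℂ} (h : IsHypGamma op om G)
    (hop : 0 < op.re) (hom : 0 < om.re) (v : ℝ) :
    hypPair G (I * ((op + om) / 2)) v =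
      4 * Complex.sinh (Real.pi * v / op) * Complex.sinh (Real.pi * v / om) := by
  have hopn : op ≠ 0 := fun h => by simp [h] at hop
  have homn : om ≠ 0 := fun h => by simp [h] at hom
  have him : ((v : ℂ) + I * ((op - om) / 2)).im = (op.re - om.re) / 2 := by simp
  have hcosh : ∀ u : ℂ, Complex.cosh (u + Real.pi / 2 * I) = I * Complex.sinh u := fun u => by
    rw [Complex.cosh_add, Complex.sinh_mul_I, Complex.cosh_mul_I, Complex.cos_pi_div_two,
      Complex.sin_pi_div_two]
    ring
  have e1 := h.add_om hop hom (z := v + I * ((op - om) / 2)) (by rw [him]; simp; linarith)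
  have e2 := h.add_op hop hom (z := -(v + I * ((op - om) / 2))) (by
    rw [Complex.neg_im, him]; simp; linarith)
  have e3 := h.reflection_of_strip (z := v + I * ((op - om) / 2)) (by
    rw [him, Complex.div_ofNat_re, Complex.add_re]
    exact abs_lt.2 ⟨by linarith, by linarith⟩)
  rw [show (v : ℂ) + I * ((op - om) / 2) + I * om = v + I * ((op + om) / 2) by ring,
    show Real.pi * (v + I * ((op - om) / 2) + I * om / 2) / op
      = Real.pi * v / op + Real.pi / 2 * I by field_simp; ring, hcosh] at e1
  rw [show -((v : ℂ) + I * ((op - om) / 2)) + I * op = -v + I * ((op + om) / 2) by ring,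
    show Real.pi * (-(v + I * ((op - om) / 2)) + I * op / 2) / om
      = -(Real.pi * v / om) + Real.pi / 2 * I by field_simp; ring, hcosh, Complex.sinh_neg] at e2
  rw [hypPair, e1, e2]
  linear_combination (-4 * I ^ 2 * Complex.sinh (Real.pi * v / op) *
    Complex.sinh (Real.pi * v / om)) * e3 - (4 * Complex.sinh (Real.pi * v / op) *
    Complex.sinh (Real.pi * v / om)) * Complex.I_mul_I

theorem four_sinh_mul_sinh {op om : ℂ} (hop : op ≠ 0) (hom : om ≠ 0) (v : ℂ) :
    4 * Complex.sinh (Real.pi * v / op) * Complex.sinh (Real.pi * v / om) =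
      planeWave (I * ((op + om) / 2) / (op * om)) v +
      planeWave (-(I * ((op + om) / 2)) / (op * om)) v -
      planeWave (I * ((op - om) / 2) / (op * om)) v -
      planeWave (-(I * ((op - om) / 2)) / (op * om)) v := by
  have hp : ∀ c : ℂ, planeWave (I * c / (op * om)) v
      = Complex.exp (-(2 * Real.pi * c * v / (op * om))) := by
    intro c
    rw [planeWave]
    congr 1
    linear_combination (2 * Real.pi * c * v / (op * om)) * Complex.I_mul_I
  rw [← mul_neg, ← mul_neg, hp, hp, hp, hp,
    show -(2 * Real.pi * ((op + om) / 2) * v / (op * om))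
      = -(Real.pi * v / op) + -(Real.pi * v / om) by field_simp; ring,
    show -(2 * Real.pi * -((op + om) / 2) * v / (op * om))
      = Real.pi * v / op + Real.pi * v / om by field_simp; ring,
    show -(2 * Real.pi * ((op - om) / 2) * v / (op * om))
      = Real.pi * v / op + -(Real.pi * v / om) by field_simp; ring,
    show -(2 * Real.pi * -((op - om) / 2) * v / (op * om))
      = -(Real.pi * v / op) + Real.pi * v / om by field_simp; ring,
    Complex.exp_add, Complex.exp_add, Complex.exp_add, Complex.exp_add, Complex.sinh, Complex.sinh]
  ring

theorem IsHypGamma.reflection_imaginary {op om c : ℂ} {G : ℂ → ℂ} (h : IsHypGamma op om G)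
    (hop : 0 < op.re) (hom : 0 < om.re) (hc : -((op + om) / 2).re < c.re)
    (hc' : (c / (op * om)).re < ((op + om) / 2 / (op * om)).re) : G (I * c) * G (-(I * c)) = 1 := by
  have hopn : op ≠ 0 := fun h => by simp [h] at hop
  have homn : om ≠ 0 := fun h => by simp [h] at hom
  refine h.reflection hop hom (by rwa [Complex.I_mul_im]) fun m n he => ?_
  rw [mul_left_cancel₀ Complex.I_ne_zero he, show ((op + om) / 2 + m * op + n * om) / (op * om)
    = (op + om) / 2 / (op * om) + ((m : ℝ) * (1 / om) + (n : ℝ) * (1 / op)) by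
      push_cast; field_simp; ring,
    Complex.add_re, Complex.add_re, Complex.re_ofReal_mul, Complex.re_ofReal_mul] at hc'
  have h1 := mul_nonneg (Nat.cast_nonneg (α := ℝ) m) (re_inv_pos hom).le
  have h2 := mul_nonneg (Nat.cast_nonneg (α := ℝ) n) (re_inv_pos hop).le
  linarith

theorem IsHypGamma.hypPair_half_sub {op om k : ℂ} {G : ℂ → ℂ} (h : IsHypGamma op om G)
    (hop : 0 < op.re) (hom : 0 < om.re) (hk : k.re < 0) :
    hypPair G (-(I * k)) (I * ((op - om) / 2)) = -hypPair G (-(I * k)) (I * ((op + om) / 2)) := by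
  have hopn : op ≠ 0 := fun h => by simp [h] at hop
  have e1 := h.add_om_imaginary hop hom (k := k) (by linarith)
  have e2 := h.add_om_imaginary hop hom (k := op + k) (by rw [Complex.add_re]; linarith)
  rw [show Real.pi * (op + k) / op = Real.pi * k / op + Real.pi by field_simp; ring,
    Complex.sin_add_pi] at e2
  simp only [hypPair]
  rw [show -(I * ((op - om) / 2)) + -(I * k) = I * ((op + om) / 2 - (op + k)) by ring, e2,
    show I * ((op + om) / 2) + -(I * k) = I * ((op + om) / 2 - k) by ring, e1,
    show -(I * ((op + om) / 2)) + -(I * k) = I * ((op - om) / 2 - (op + k)) by ring,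
    show I * ((op - om) / 2) + -(I * k) = I * ((op - om) / 2 - k) by ring]
  ring

theorem hypPair_neg (G : ℂ → ℂ) (z x : ℂ) : hypPair G z (-x) = hypPair G z x := by
  rw [hypPair, hypPair, neg_neg, mul_comm]

theorem integral_hypPair_mul_hypPair_of_im_ne_zero {G : ℂ → ℂ → ℂ → ℂ}
    (hG : ∀ a b : ℂ, 0 < a.re → 0 < b.re → IsHypGamma a b (G a b)) {op om k : ℂ}
    (hop : 0 < op.re) (hom : 0 < om.re) (hr : (op / om).im ≠ 0) (hk : k.re < 0)
    (hkp : 0 < (k / (op * om)).re) :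
    (∫ v : ℝ, hypPair (G op om) (I * ((op + om) / 2)) v *
      hypPair (G op om) (-(I * (k + (op + om) / 2))) v) *
      hypPair (G op om) (-(I * k)) (I * ((op + om) / 2)) =
    4 * (op * om) ^ ((1:ℂ) / 2) * G op om (-(I * (2 * k + (op + om) / 2))) := by
  have hopn : op ≠ 0 := fun h => by simp [h] at hop
  have homn : om ≠ 0 := fun h => by simp [h] at hom
  have h := hG op om hop hom
  have hdec := hypPair_expDecay hG hop hom hk
  obtain ⟨δ, hδ0, -, hcell⟩ := exists_cell_subset_cmStrip hop hom hk hkp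
  have habs : |(1 / 2 : ℝ)| < 1 / 2 + δ := by rw [abs_of_pos (by norm_num)]; linarith
  have habs' : |(-(1 / 2) : ℝ)| < 1 / 2 + δ := by rwa [abs_neg]
  have m1 : I * ((op + om) / 2) ∈ cmStrip op om k := by
    convert hcell _ _ habs habs using 1; push_cast; ring
  have m2 : -(I * ((op + om) / 2)) ∈ cmStrip op om k := by
    convert hcell _ _ habs' habs' using 1; push_cast; ring
  have m3 : I * ((op - om) / 2) ∈ cmStrip op om k := by
    convert hcell _ _ habs habs' using 1; push_cast; ring
  have m4 : -(I * ((op - om) / 2)) ∈ cmStrip op om k := by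
    convert hcell _ _ habs' habs using 1; push_cast; ring
  have i1 := hdec.integrable m1.1
  have i2 := hdec.integrable m2.1
  have i3 := hdec.integrable m3.1
  have i4 := hdec.integrable m4.1
  have hI : ∫ v : ℝ, hypPair (G op om) (I * ((op + om) / 2)) v *
      hypPair (G op om) (-(I * (k + (op + om) / 2))) v =
      hypFourier (G op om) (-(I * (k + (op + om) / 2))) (op * om) (I * ((op + om) / 2)) +
      hypFourier (G op om) (-(I * (k + (op + om) / 2))) (op * om) (-(I * ((op + om) / 2))) -
      hypFourier (G op om) (-(I * (k + (op + om) / 2))) (op * om) (I * ((op - om) / 2)) -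
      hypFourier (G op om) (-(I * (k + (op + om) / 2))) (op * om) (-(I * ((op - om) / 2))) := by
    simp only [hypFourier]
    rw [← integral_add' i1 i2, ← integral_sub' (i1.add i2) i3, ← integral_sub' ((i1.add i2).sub i3) i4]
    congr 1
    ext v
    rw [h.hypPair_half_add hop hom, four_sinh_mul_sinh hopn homn]
    simp only [Pi.add_apply, Pi.sub_apply]
    ring
  have r1 := cmProduct_eq_const hG hop hom hr hk hkp m1
  have r2 := cmProduct_eq_const hG hop hom hr hk hkp m2
  have r3 := cmProduct_eq_const hG hop hom hr hk hkp m3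
  have r4 := cmProduct_eq_const hG hop hom hr hk hkp m4
  rw [mul_hypGamma_half_sub hG hop hom, cmProduct] at r1 r2 r3 r4
  rw [hypPair_neg] at r2 r4
  rw [h.hypPair_half_sub hop hom hk] at r3 r4
  rw [hI]
  linear_combination r1 + r2 + r3 + r4

/-- The integrand of the Cherednik–Macdonald integral, as a function of `ω₊`. -/
def cmIntegrand (G : ℂ → ℂ → ℂ → ℂ) (om k op : ℂ) (v : ℝ) : ℂ :=
  hypPair (G op om) (I * ((op + om) / 2)) v * hypPair (G op om) (-(I * (k + (op + om) / 2))) v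

theorem cmIntegrand_bound {G : ℂ → ℂ → ℂ → ℂ}
    (hG : ∀ a b : ℂ, 0 < a.re → 0 < b.re → IsHypGamma a b (G a b)) {op om k : ℂ}
    (hop : 0 < op.re) (hom : 0 < om.re) (hk : k.re < 0) (hkp : 0 < (k / (op * om)).re) :
    ∃ C : ℝ, ∀ᶠ c in 𝓝 op, ∀ v : ℝ,
      ‖cmIntegrand G om k c v‖ ≤ C * Real.exp (-(Real.pi * (k / (op * om)).re * |v|)) := by
  have hopn : op ≠ 0 := fun h => by simp [h] at hop
  have homn : om ≠ 0 := fun h => by simp [h] at hom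
  obtain ⟨C₁, hC₁, hb₁⟩ := hypPair_bound hG hop hom (z := I * ((op + om) / 2)) (by
    rw [Complex.I_mul_im]; simp; linarith)
  obtain ⟨C₂, hC₂, hb₂⟩ := hypPair_bound hG hop hom (z := -(I * (k + (op + om) / 2))) (by
    rw [Complex.neg_im, Complex.I_mul_im, Complex.add_re]; linarith)
  have t₁ : Tendsto (fun c : ℂ => (c, I * ((c + om) / 2))) (𝓝 op)
      (𝓝 (op, I * ((op + om) / 2))) :=
    Continuous.tendsto (f := fun c : ℂ => (c, I * ((c + om) / 2))) (by fun_prop) op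
  have t₂ : Tendsto (fun c : ℂ => (c, -(I * (k + (c + om) / 2)))) (𝓝 op)
      (𝓝 (op, -(I * (k + (op + om) / 2)))) :=
    Continuous.tendsto (f := fun c : ℂ => (c, -(I * (k + (c + om) / 2)))) (by fun_prop) op
  have hrate : ∀ᶠ c in 𝓝 op, (k / (op * om)).re / 2 < (k / (c * om)).re := by
    have hc : ContinuousAt (fun c : ℂ => (k / (c * om)).re) op :=
      Complex.continuous_re.continuousAt.comp
        (continuousAt_const.div (by fun_prop) (mul_ne_zero hopn homn))
    exact continuousAt_const.eventually_lt hc (by linarith)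
  refine ⟨C₁ * C₂, ?_⟩
  filter_upwards [t₁.eventually hb₁, t₂.eventually hb₂, hrate] with c h₁ h₂ h₃ v
  rw [cmIntegrand, norm_mul]
  calc _ ≤ (C₁ * Real.exp (-(2 * Real.pi * (I * (I * ((c + om) / 2) / (c * om))).re * |v|))) *
        (C₂ * Real.exp (-(2 * Real.pi * (I * (-(I * (k + (c + om) / 2)) / (c * om))).re * |v|))) :=
        mul_le_mul (h₁ v) (h₂ v) (norm_nonneg _) (by positivity)
    _ = C₁ * C₂ * Real.exp (-(2 * Real.pi * (k / (c * om)).re * |v|)) := by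
        rw [mul_mul_mul_comm, ← Real.exp_add]
        congr 2
        have e : k / (c * om) = I * (I * ((c + om) / 2) / (c * om)) +
            I * (-(I * (k + (c + om) / 2)) / (c * om)) := by
          linear_combination (k / (c * om)) * Complex.I_mul_I
        rw [e, Complex.add_re]
        ring
    _ ≤ _ := by
        have := Real.pi_pos
        gcongr C₁ * C₂ * Real.exp (-(?_ * _))
        nlinarith

theorem continuous_cmIntegrand {G : ℂ → ℂ → ℂ → ℂ}
    (hG : ∀ a b : ℂ, 0 < a.re → 0 < b.re → IsHypGamma a b (G a b)) {op om k : ℂ}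
    (hop : 0 < op.re) (hom : 0 < om.re) (hk : k.re < 0) : Continuous (cmIntegrand G om k op) := by
  have h := hG op om hop hom
  exact (h.continuous_hypPair hop hom (by rw [Complex.I_mul_im]; simp; linarith)).mul
    (h.continuous_hypPair hop hom (by
      rw [Complex.neg_im, Complex.I_mul_im, Complex.add_re]; linarith))

theorem integrable_cmIntegrand {G : ℂ → ℂ → ℂ → ℂ}
    (hG : ∀ a b : ℂ, 0 < a.re → 0 < b.re → IsHypGamma a b (G a b)) {op om k : ℂ}
    (hop : 0 < op.re) (hom : 0 < om.re) (hk : k.re < 0) (hkp : 0 < (k / (op * om)).re) :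
    Integrable (cmIntegrand G om k op) := by
  obtain ⟨C, hC⟩ := cmIntegrand_bound hG hop hom hk hkp
  have := Real.pi_pos
  exact ((integrable_exp_neg_mul_abs (by positivity)).const_mul C).mono'
    (continuous_cmIntegrand hG hop hom hk).aestronglyMeasurable
    (Eventually.of_forall hC.self_of_nhds)

theorem continuousAt_hypGamma_comp {G : ℂ → ℂ → ℂ → ℂ}
    (hG : ∀ a b : ℂ, 0 < a.re → 0 < b.re → IsHypGamma a b (G a b)) {op om : ℂ} {f : ℂ → ℂ}
    (hop : 0 < op.re) (hom : 0 < om.re) (hf : ContinuousAt f op)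
    (hz : -((op + om) / 2).re < (f op).im) : ContinuousAt (fun c => G c om (f c)) op :=
  ContinuousAt.comp (f := fun c : ℂ => (c, f c)) (continuousAt_hypGamma_family hG hop hom hz)
    (by fun_prop)

theorem integral_cmIntegrand_mul {G : ℂ → ℂ → ℂ → ℂ}
    (hG : ∀ a b : ℂ, 0 < a.re → 0 < b.re → IsHypGamma a b (G a b)) {op om k : ℂ}
    (hop : 0 < op.re) (hom : 0 < om.re) (hk : k.re < 0) (hkp : 0 < (k / (op * om)).re) :
    (∫ v : ℝ, cmIntegrand G om k op v) * hypPair (G op om) (-(I * k)) (I * ((op + om) / 2)) =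
    4 * (op * om) ^ ((1:ℂ) / 2) * G op om (-(I * (2 * k + (op + om) / 2))) := by
  rcases ne_or_eq (op / om).im 0 with hr | hr
  · exact integral_hypPair_mul_hypPair_of_im_ne_zero hG hop hom hr hk hkp
  have hopn : op ≠ 0 := fun h => by simp [h] at hop
  have homn : om ≠ 0 := fun h => by simp [h] at hom
  have hcre : ∀ᶠ c : ℂ in 𝓝 op, 0 < c.re :=
    Complex.continuous_re.continuousAt.eventually (lt_mem_nhds hop)
  have hckp : ∀ᶠ c : ℂ in 𝓝 op, 0 < (k / (c * om)).re := by
    have hc : ContinuousAt (fun c : ℂ => (k / (c * om)).re) op :=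
      Complex.continuous_re.continuousAt.comp
        (continuousAt_const.div (by fun_prop) (mul_ne_zero hopn homn))
    exact hc.eventually (lt_mem_nhds hkp)
  have hW : ((op + om) / 2).re = (op.re + om.re) / 2 := by simp
  have cI : ContinuousAt (fun c => ∫ v : ℝ, cmIntegrand G om k c v) op := by
    obtain ⟨C, hC⟩ := cmIntegrand_bound hG hop hom hk hkp
    have := Real.pi_pos
    refine continuousAt_of_dominated
      (hcre.mono fun c hc => (continuous_cmIntegrand hG hc hom hk).aestronglyMeasurable)
      (hC.mono fun c hc => Eventually.of_forall hc)
      ((integrable_exp_neg_mul_abs (by positivity)).const_mul C) (Eventually.of_forall fun v => ?_)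
    refine ContinuousAt.mul (ContinuousAt.mul ?_ ?_) (ContinuousAt.mul ?_ ?_) <;>
    · refine continuousAt_hypGamma_comp hG hop hom (by fun_prop) ?_
      simp
      linarith
  have cB : ContinuousAt (fun c => hypPair (G c om) (-(I * k)) (I * ((c + om) / 2))) op := by
    refine ContinuousAt.mul ?_ ?_ <;>
    · refine continuousAt_hypGamma_comp hG hop hom (by fun_prop) ?_
      simp
      linarith
  have cG : ContinuousAt (fun c => G c om (-(I * (2 * k + (c + om) / 2)))) op := by
    refine continuousAt_hypGamma_comp hG hop hom (by fun_prop) ?_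
    simp
    linarith
  have cP : ContinuousAt (fun c : ℂ => (c * om) ^ ((1:ℂ) / 2)) op :=
    ContinuousAt.cpow (by fun_prop) continuousAt_const (mul_mem_slitPlane hop hom)
  refine tendsto_nhds_unique_of_frequently_eq (cI.mul cB) ((continuousAt_const.mul cP).mul cG) ?_
  have hpath : Tendsto (fun t : ℝ => op * Complex.exp (t * I)) (𝓝[>] 0) (𝓝 op) := by
    have : ContinuousAt (fun t : ℝ => op * Complex.exp (t * I)) 0 := by fun_prop
    simpa using this.tendsto.mono_left (nhdsWithin_le_nhds (s := Ioi 0))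
  refine hpath.frequently (Eventually.frequently ?_)
  filter_upwards [hpath.eventually hcre, hpath.eventually hckp, self_mem_nhdsWithin,
    nhdsWithin_le_nhds (gt_mem_nhds Real.pi_pos)] with t h1 h2 h3 h4
  refine integral_hypPair_mul_hypPair_of_im_ne_zero hG h1 hom ?_ hk h2
  have hre : op / om = ((op / om).re : ℂ) := Complex.ext (by simp) (by simpa using hr)
  have hne : (op / om).re ≠ 0 := fun h0 => div_ne_zero hopn homn (by rw [hre, h0]; simp)
  rw [mul_div_right_comm, hre, Complex.im_ofReal_mul, Complex.exp_ofReal_mul_I_im]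
  exact mul_ne_zero hne (Real.sin_pos_of_pos_of_lt_pi h3 h4).ne'

theorem IsHypGamma.ae_integrand_eq {G : ℂ → ℂ → ℂ → ℂ} {op om k : ℂ}
    (h : IsHypGamma op om (G op om)) (hop : 0 < op.re) (hom : 0 < om.re) (hk : k.re < 0) :
    cmIntegrand G om k op =ᵐ[volume] fun v : ℝ =>
      G op om ((v:ℂ) + Complex.I*(op+om)/2) * G op om (-(v:ℂ) + Complex.I*(op+om)/2) /
        (G op om ((v:ℂ) + Complex.I*(k+(op+om)/2)) *
          G op om (-(v:ℂ) + Complex.I*(k+(op+om)/2))) := by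
  have hcount : ∀ X : ℕ × ℕ → ℂ, ∀ᵐ v : ℝ, (v : ℂ) ∉ range X := fun X =>
    ((countable_range X).preimage Complex.ofReal_injective).ae_notMem volume
  have key : ∀ v : ℝ, (∀ m n : ℕ, (v : ℂ) - I * (k + (op + om) / 2) ≠
      I * ((op + om) / 2 + m * op + n * om)) →
      G op om (v + -(I * (k + (op + om) / 2))) = (G op om (-v + I * (k + (op + om) / 2)))⁻¹ := by
    intro v hv
    have hr := h.reflection hop hom (z := v - I * (k + (op + om) / 2)) (by
      rw [Complex.sub_im, Complex.I_mul_im, Complex.ofReal_im, Complex.add_re]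
      linarith) hv
    rw [show -((v : ℂ) - I * (k + (op + om) / 2)) = -v + I * (k + (op + om) / 2) by ring] at hr
    rw [← sub_eq_add_neg]
    exact eq_inv_of_mul_eq_one_left hr
  filter_upwards [hcount fun q => I * (k + (op + om) / 2) +
      I * ((op + om) / 2 + q.1 * op + q.2 * om), hcount fun q => -(I * (k + (op + om) / 2) +
      I * ((op + om) / 2 + q.1 * op + q.2 * om))] with v h1 h2
  have k1 := key v fun m n he => h1 ⟨(m, n), by linear_combination -he⟩
  have k2 := key (-v) fun m n he => h2 ⟨(m, n), by push_cast at he; linear_combination he⟩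
  rw [Complex.ofReal_neg, neg_neg] at k2
  rw [cmIntegrand, hypPair, hypPair, k1, k2, mul_div_assoc I]
  ring

/-- **Generalized Cherednik–Macdonald identity for the rank-one root system `A₁`**
(the hyperbolic Askey–Wilson integral specialization, equation (4.4) of the paper). -/
theorem generalized_CM_A1
    (G : ℂ → ℂ → ℂ → ℂ)
    (hG : ∀ a b : ℂ, 0 < a.re → 0 < b.re → IsHypGamma a b (G a b))
    (op om k : ℂ) (hop : 0 < op.re) (hom : 0 < om.re) (him : (op*om).im < 0)
    (hk1 : k.re < 0) (hk2 : ∃ w : ℂ, 0 < w.re ∧ k = op*om*w) :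
    Integrable (fun v : ℝ =>
      G op om ((v:ℂ) + Complex.I*(op+om)/2) * G op om (-(v:ℂ) + Complex.I*(op+om)/2) /
        (G op om ((v:ℂ) + Complex.I*(k+(op+om)/2)) *
          G op om (-(v:ℂ) + Complex.I*(k+(op+om)/2)))) ∧
    ∫ v : ℝ,
        G op om ((v:ℂ) + Complex.I*(op+om)/2) * G op om (-(v:ℂ) + Complex.I*(op+om)/2) /
          (G op om ((v:ℂ) + Complex.I*(k+(op+om)/2)) *
            G op om (-(v:ℂ) + Complex.I*(k+(op+om)/2))) =
      4 * (op*om) ^ ((1:ℂ)/2) *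
        G op om (Complex.I*(k+(op+om)/2)) * G op om (Complex.I*(k-(op+om)/2)) /
          G op om (Complex.I*(2*k+(op+om)/2)) := by
  have h := hG op om hop hom
  have hopn : op ≠ 0 := fun h => by simp [h] at hop
  have homn : om ≠ 0 := fun h => by simp [h] at hom
  have hkp : 0 < (k / (op * om)).re := by
    obtain ⟨w, hw, rfl⟩ := hk2
    rwa [mul_div_cancel_left₀ _ (mul_ne_zero hopn homn)]
  have hae := h.ae_integrand_eq hop hom hk1
  refine ⟨(integrable_cmIntegrand hG hop hom hk1 hkp).congr hae, ?_⟩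
  rw [← integral_congr_ae hae]
  have hW : ((op + om) / 2).re = (op.re + om.re) / 2 := by simp
  have hω : 0 < ((op + om) / 2 / (op * om)).re := by
    rw [show (op + om) / 2 / (op * om) = (1 / op + 1 / om) / 2 by field_simp; ring]
    have := re_inv_pos hop
    have := re_inv_pos hom
    simp only [Complex.div_ofNat_re, Complex.add_re]
    linarith
  have r1 := h.reflection_imaginary hop hom (c := -(k + (op + om) / 2))
    (by rw [Complex.neg_re, Complex.add_re]; linarith)
    (by rw [neg_div, Complex.neg_re, add_div, Complex.add_re]; linarith)
  have r2 := h.reflection_imaginary hop hom (c := -(k - (op + om) / 2))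
    (by rw [Complex.neg_re, Complex.sub_re]; linarith)
    (by rw [neg_div, Complex.neg_re, sub_div, Complex.sub_re]; linarith)
  have r3 := h.reflection_imaginary hop hom (c := -(2 * k + (op + om) / 2))
    (by rw [Complex.neg_re, two_mul, Complex.add_re, Complex.add_re]; linarith)
    (by rw [neg_div, Complex.neg_re, two_mul, add_div, add_div, Complex.add_re, Complex.add_re]
        linarith)
  simp only [mul_neg, neg_neg] at r1 r2 r3
  have hmain := integral_cmIntegrand_mul hG hop hom hk1 hkp
  rw [hypPair, show I * ((op + om) / 2) + -(I * k) = -(I * (k - (op + om) / 2)) by ring,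
    show -(I * ((op + om) / 2)) + -(I * k) = -(I * (k + (op + om) / 2)) by ring] at hmain
  rw [eq_div_iff (right_ne_zero_of_mul_eq_one r3)]
  set J := ∫ v : ℝ, cmIntegrand G om k op v
  linear_combination (G op om (I * (k + (op + om) / 2)) * G op om (I * (k - (op + om) / 2)) *
    G op om (I * (2 * k + (op + om) / 2))) * hmain - J * G op om (I * (2 * k + (op + om) / 2)) *
    (G op om (-(I * (k + (op + om) / 2))) * G op om (I * (k + (op + om) / 2)) * r2 + r1) +
    4 * (op * om) ^ ((1:ℂ) / 2) * G op om (I * (k + (op + om) / 2)) *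
    G op om (I * (k - (op + om) / 2)) * r3

end
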